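/- arXiv:2006.08308 — 4 statements merged into one kernel-verified Lean document; each statement's English description precedes it below -/
import Mathlib

section
/- Let D ⊆ ℂ be a domain and 𝓕 a family of holomorphic functions on D. If z₀ ∈ J(𝓕) and N ⊆ D is any neighborhood of z₀, then the complement ℂ \ U of the set U = ⋃_{f ∈ 𝓕} f(N) contains at most one point. -/
open Filter Topology

/-- A sequence of complex functions tends to `∞` locally uniformly on `U`:
on every compact subset of `U` the moduli eventually exceed any bound,
uniformly. -/
def TendstoInftyLocallyUniformlyOn (F : ℕ → ℂ → ℂ) (U : Set ℂ) : Prop :=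
  ∀ M : ℝ, ∀ K ⊆ U, IsCompact K → ∀ᶠ n in atTop, ∀ z ∈ K, M ≤ ‖F n z‖

/-- The family `𝓕` is normal at the point `z₀` of the domain `D`: there is a
neighborhood `U ⊆ D` of `z₀` on which every sequence in `𝓕` has a subsequence
converging locally uniformly either to a holomorphic function or to `∞`. -/
def IsNormalAt (𝓕 : Set (ℂ → ℂ)) (D : Set ℂ) (z₀ : ℂ) : Prop :=
  ∃ U : Set ℂ, IsOpen U ∧ z₀ ∈ U ∧ U ⊆ D ∧
    ∀ f : ℕ → ℂ → ℂ, (∀ n, f n ∈ 𝓕) →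
      ∃ φ : ℕ → ℕ, StrictMono φ ∧
        ((∃ g : ℂ → ℂ, DifferentiableOn ℂ g U ∧
            TendstoLocallyUniformlyOn (fun n => f (φ n)) g atTop U) ∨
          TendstoInftyLocallyUniformlyOn (fun n => f (φ n)) U)

/-- The Fatou like set of the family `𝓕` on the domain `D`. -/
def fatouLike (𝓕 : Set (ℂ → ℂ)) (D : Set ℂ) : Set ℂ :=
  {z ∈ D | IsNormalAt 𝓕 D z}

/-- The Julia like set of the family `𝓕` on the domain `D`. -/
def juliaLike (𝓕 : Set (ℂ → ℂ)) (D : Set ℂ) : Set ℂ :=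
  D \ fatouLike 𝓕 D

open Metric in
/-- A nonvanishing holomorphic function on a disc has a holomorphic logarithm. -/
theorem exists_differentiableOn_exp_eq {f : ℂ → ℂ} {c : ℂ} {r : ℝ} (hr : 0 < r)
    (hf : DifferentiableOn ℂ f (ball c r)) (h0 : ∀ z ∈ ball c r, f z ≠ 0) :
    ∃ h : ℂ → ℂ, DifferentiableOn ℂ h (ball c r) ∧ h c = Complex.log (f c) ∧
      ∀ z ∈ ball c r, Complex.exp (h z) = f z := by
  have hd : DifferentiableOn ℂ (fun z => deriv f z / f z) (ball c r) :=
    (hf.deriv isOpen_ball).div hf h0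
  obtain ⟨h, hc, hh⟩ := hd.isExactOn_ball.with_val_at c (Complex.log (f c))
  have hhd : DifferentiableOn ℂ h (ball c r) :=
    fun z hz => (hh z hz).differentiableAt.differentiableWithinAt
  have hcr : c ∈ ball c r := mem_ball_self hr
  refine ⟨h, hhd, hc, fun z hz => ?_⟩
  have key : ∀ w ∈ ball c r, HasDerivAt (fun z => f z * Complex.exp (-h z)) 0 w := by
    intro w hw
    have h1 := (hf.differentiableAt (isOpen_ball.mem_nhds hw)).hasDerivAt.mul (hh w hw).neg.cexp
    refine h1.congr_deriv ?_
    have h2 : f w * (deriv f w / f w) = deriv f w := mul_div_cancel₀ _ (h0 w hw)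
    simp only [Pi.neg_apply]
    linear_combination -Complex.exp (-h w) * h2
  have hconst : f z * Complex.exp (-h z) = f c * Complex.exp (-h c) :=
    isOpen_ball.is_const_of_deriv_eq_zero (convex_ball c r).isPreconnected
      (fun w hw => (key w hw).differentiableAt.differentiableWithinAt)
      (fun w hw => (key w hw).deriv) hz hcr
  rw [hc, Complex.exp_neg, Complex.exp_neg, Complex.exp_log (h0 c hcr),
    mul_inv_cancel₀ (h0 c hcr)] at hconst
  exact (eq_of_mul_inv_eq_one hconst).symm

open Metric in
/-- A version of **Bloch's theorem**. -/
theorem exists_ball_subset_image_ball {g : ℂ → ℂ} {c : ℂ} {r : ℝ} (hr : 0 < r)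
    (hg : DifferentiableOn ℂ g (ball c r)) :
    ∃ w, ball w (r * ‖deriv g c‖ / 128) ⊆ g '' ball c r := by
  rcases eq_or_ne (deriv g c) 0 with h0 | h0
  · exact ⟨0, by simp [h0]⟩
  have hg' : DifferentiableOn ℂ (deriv g) (ball c r) := hg.deriv isOpen_ball
  have hsub : closedBall c (r / 2) ⊆ ball c r := closedBall_subset_ball (by linarith)
  obtain ⟨a, ha, hmax⟩ := (isCompact_closedBall c (r / 2)).exists_isMaxOn
    (f := fun z => ‖deriv g z‖ * (r / 2 - dist z c))
    ⟨c, mem_closedBall_self (by linarith)⟩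
    ((hg'.continuousOn.mono hsub).norm.mul (by fun_prop))
  have hac : ‖deriv g c‖ * (r / 2) ≤ ‖deriv g a‖ * (r / 2 - dist a c) := by
    simpa using hmax (mem_closedBall_self (by linarith : (0 : ℝ) ≤ r / 2))
  have hpos : 0 < ‖deriv g a‖ * (r / 2 - dist a c) :=
    lt_of_lt_of_le (by have := norm_pos_iff.2 h0; positivity) hac
  have hA : 0 < ‖deriv g a‖ := by
    rcases (norm_nonneg (deriv g a)).eq_or_lt with h | h
    · rw [← h] at hpos; simp at hpos
    · exact h
  have hs : 0 < r / 2 - dist a c := by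
    by_contra! h
    nlinarith
  obtain ⟨ρ, hρ⟩ : ∃ ρ, r / 2 - dist a c = 2 * ρ := ⟨(r / 2 - dist a c) / 2, by ring⟩
  rw [hρ] at hs hac
  have hρ0 : 0 < ρ := by linarith
  have hball : ∀ z ∈ ball a ρ, z ∈ closedBall c (r / 2) ∧ ρ ≤ r / 2 - dist z c := by
    intro z hz
    have h1 := dist_triangle z a c
    rw [mem_ball] at hz
    exact ⟨by rw [mem_closedBall]; linarith, by linarith⟩
  have hballr : ball a ρ ⊆ ball c r := fun z hz => hsub (hball z hz).1
  have hbound : ∀ z ∈ ball a ρ, ‖deriv g z‖ ≤ 2 * ‖deriv g a‖ := by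
    intro z hz
    have h1 : ‖deriv g z‖ * (r / 2 - dist z c) ≤ ‖deriv g a‖ * (r / 2 - dist a c) :=
      hmax (hball z hz).1
    rw [hρ] at h1
    have h2 := mul_le_mul_of_nonneg_left (hball z hz).2 (norm_nonneg (deriv g z))
    nlinarith
  have hmaps : Set.MapsTo (deriv g) (ball a ρ) (closedBall (deriv g a) (4 * ‖deriv g a‖)) := by
    intro z hz
    rw [mem_closedBall, dist_eq_norm]
    linarith [norm_sub_le (deriv g z) (deriv g a), hbound z hz]
  have hsub8 : closedBall a (ρ / 8) ⊆ ball a ρ := closedBall_subset_ball (by linarith)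
  have hdiff : ∀ z ∈ closedBall a (ρ / 8), ‖deriv g z - deriv g a‖ ≤ ‖deriv g a‖ / 2 := by
    intro z hz
    have h1 := Complex.dist_le_div_mul_dist_of_mapsTo_ball (hg'.mono hballr) hmaps (hsub8 hz)
    rw [dist_eq_norm] at h1
    refine h1.trans ?_
    rw [mem_closedBall] at hz
    calc 4 * ‖deriv g a‖ / ρ * dist z a ≤ 4 * ‖deriv g a‖ / ρ * (ρ / 8) := by gcongr
      _ = ‖deriv g a‖ / 2 := by field_simp; norm_num
  have hlin : ∀ z ∈ sphere a (ρ / 8), ‖deriv g a‖ * ρ / 16 ≤ ‖g z - g a‖ := by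
    intro z hz
    have hz' := sphere_subset_closedBall hz
    have h1 := (convex_closedBall a (ρ / 8)).norm_image_sub_le_of_norm_hasDerivWithin_le
      (f := fun z => g z - deriv g a * z) (f' := fun z => deriv g z - deriv g a)
      (fun x hx => by
        have h2 := (hg.differentiableAt
          (isOpen_ball.mem_nhds (hballr (hsub8 hx)))).hasDerivAt
        have h3 := h2.sub ((hasDerivAt_id x).const_mul (deriv g a))
        rw [mul_one] at h3
        exact h3.hasDerivWithinAt)
      hdiff (mem_closedBall_self (by linarith)) hz'
    rw [mem_sphere, dist_eq_norm] at hz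
    rw [hz] at h1
    have h4 : ‖deriv g a * (z - a)‖ = ‖deriv g a‖ * (ρ / 8) := by rw [norm_mul, hz]
    have h5 := norm_sub_le (g z - g a) (g z - deriv g a * z - (g a - deriv g a * a))
    have h6 : g z - g a - (g z - deriv g a * z - (g a - deriv g a * a)) =
      deriv g a * (z - a) := by ring
    rw [h6, h4] at h5
    linarith
  have hga : DifferentiableAt ℂ g a :=
    hg.differentiableAt (isOpen_ball.mem_nhds (hballr (mem_ball_self hρ0)))
  have hfreq : ∃ᶠ z in 𝓝 a, g z ≠ g a := by
    intro hcon
    have h1 : g =ᶠ[𝓝 a] fun _ => g a := by filter_upwards [hcon] with z hz using not_not.1 hz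
    rw [h1.deriv_eq] at hA
    simp at hA
  have hdcc : DiffContOnCl ℂ g (ball a (ρ / 8)) :=
    (hg.mono (hsub8.trans hballr)).diffContOnCl_ball subset_rfl
  have himg := hdcc.ball_subset_image_closedBall (by linarith) hlin hfreq
  refine ⟨g a, (ball_subset_ball ?_).trans (himg.trans (Set.image_mono (hsub8.trans hballr)))⟩
  nlinarith

theorem exists_dist_lt_cos_eq_intCast (w : ℂ) :
    ∃ v : ℂ, dist v w < 10 ∧ ∃ n : ℤ, Complex.cos v = n := by
  obtain ⟨n, hn1, hn2⟩ : ∃ n : ℤ, (1 : ℝ) ≤ n ∧ (n : ℝ) ≤ Real.cosh w.im ∧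
      Real.cosh w.im < n + 1 := by
    refine ⟨⌊Real.cosh w.im⌋, ?_, Int.floor_le _, Int.lt_floor_add_one _⟩
    exact_mod_cast Int.le_floor.2 (by simp)
  obtain ⟨hn2, hn3⟩ := hn2
  obtain ⟨t, ht, hcosh⟩ : ∃ t ∈ Set.Icc 0 |w.im|, Real.cosh t = n := by
    have := intermediate_value_Icc (abs_nonneg w.im) Real.continuous_cosh.continuousOn
    exact this ⟨by simpa using hn1, by simpa using hn2⟩
  have hlog : |w.im| - t < 2 := by
    have h1 : Real.exp |w.im| < 4 * Real.exp t := by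
      have e1 : Real.cosh |w.im| < 2 * Real.cosh t := by
        rw [Real.cosh_abs, hcosh]; linarith
      rw [Real.cosh_eq, Real.cosh_eq] at e1
      have := Real.exp_pos (-|w.im|)
      have : Real.exp (-t) ≤ Real.exp t := Real.exp_le_exp.2 (by linarith [ht.1])
      linarith
    have h2 : (4 : ℝ) ≤ Real.exp 2 := by
      have := Real.exp_one_gt_d9
      have h : Real.exp 2 = Real.exp 1 * Real.exp 1 := by rw [← Real.exp_add]; norm_num
      nlinarith
    by_contra! h
    have h3 : Real.exp (2 + t) ≤ Real.exp |w.im| := Real.exp_le_exp.2 (by linarith)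
    rw [Real.exp_add] at h3
    nlinarith [Real.exp_pos t]
  obtain ⟨s, hs1, hs2⟩ : ∃ s : ℝ, |s - w.im| < 2 ∧ Real.cosh s = n := by
    rcases le_total 0 w.im with h | h
    · rw [abs_of_nonneg h] at hlog ht
      exact ⟨t, by rw [abs_lt]; constructor <;> linarith [ht.1, ht.2], hcosh⟩
    · rw [abs_of_nonpos h] at hlog ht
      exact ⟨-t, by rw [abs_lt]; constructor <;> linarith [ht.1, ht.2],
        by rw [Real.cosh_neg, hcosh]⟩
  set k := round (w.re / (2 * Real.pi)) with hk
  refine ⟨s * Complex.I + k * (2 * Real.pi), ?_, n, ?_⟩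
  · rw [dist_eq_norm]
    refine (Complex.norm_le_abs_re_add_abs_im _).trans_lt ?_
    have hre : |k * (2 * Real.pi) - w.re| ≤ Real.pi := by
      have h1 := abs_sub_round (w.re / (2 * Real.pi))
      rw [← hk] at h1
      have h2 : (k : ℝ) * (2 * Real.pi) - w.re =
          -(w.re / (2 * Real.pi) - k) * (2 * Real.pi) := by
        field_simp
        ring
      rw [h2, abs_mul, abs_neg, abs_of_pos Real.two_pi_pos]
      nlinarith [Real.pi_pos]
    have e1 : (s * Complex.I + k * (2 * Real.pi) - w).re = k * (2 * Real.pi) - w.re := by simp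
    have e2 : (s * Complex.I + k * (2 * Real.pi) - w).im = s - w.im := by simp
    rw [e1, e2]
    linarith [Real.pi_le_four]
  · rw [Complex.cos_add_int_mul_two_pi, Complex.cos_mul_I, ← Complex.ofReal_cosh, hs2]
    simp

open Metric in
theorem norm_sub_le_of_cos_ne_intCast {g : ℂ → ℂ} {c : ℂ} {R : ℝ} (hR : 0 < R)
    (hg : DifferentiableOn ℂ g (ball c R))
    (hcos : ∀ z ∈ ball c R, ∀ n : ℤ, Complex.cos (g z) ≠ n) :
    ∀ z ∈ ball c (R / 2), ‖g z - g c‖ ≤ 1280 := by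
  have hsub : ∀ z ∈ ball c (R / 2), ball z (R / 2) ⊆ ball c R := fun z hz =>
    ball_subset_ball' (by rw [mem_ball] at hz; linarith)
  have hderiv : ∀ z ∈ ball c (R / 2), ‖deriv g z‖ ≤ 2560 / R := by
    intro z hz
    obtain ⟨w, hw⟩ := exists_ball_subset_image_ball (half_pos hR) (hg.mono (hsub z hz))
    obtain ⟨v, hv, n, hn⟩ := exists_dist_lt_cos_eq_intCast w
    by_contra! hcon
    rw [div_lt_iff₀ hR] at hcon
    obtain ⟨x, hx, rfl⟩ := hw (mem_ball.2 (by linarith : dist v w < R / 2 * ‖deriv g z‖ / 128))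
    exact hcos x (hsub z hz hx) n hn
  intro z hz
  have h1 := (convex_ball c (R / 2)).norm_image_sub_le_of_norm_deriv_le
    (fun x hx => hg.differentiableAt (isOpen_ball.mem_nhds (ball_subset_ball (by linarith) hx)))
    hderiv (mem_ball_self (half_pos hR)) hz
  rw [mem_ball, dist_eq_norm] at hz
  calc ‖g z - g c‖ ≤ 2560 / R * ‖z - c‖ := h1
    _ ≤ 2560 / R * (R / 2) := by gcongr
    _ = 1280 := by field_simp; norm_num

open Metric in
theorem norm_le_of_ne_intCast {h : ℂ → ℂ} {c : ℂ} {R : ℝ} (hR : 0 < R)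
    (hh : DifferentiableOn ℂ h (ball c R)) (hint : ∀ z ∈ ball c R, ∀ n : ℤ, h z ≠ n) :
    ∀ z ∈ ball c (R / 2), ‖h z‖ ≤ (2 * ‖h c‖ + 1) * Real.exp 1280 := by
  have hne : ∀ z ∈ ball c R, 1 - h z ^ 2 ≠ 0 := by
    intro z hz h0
    have h1 : (h z - 1) * (h z + 1) = 0 := by linear_combination -h0
    rcases mul_eq_zero.1 h1 with h2 | h2
    · exact hint z hz 1 (by push_cast; linear_combination h2)
    · exact hint z hz (-1) (by push_cast; linear_combination h2)
  obtain ⟨l, hl, -, hexp⟩ := exists_differentiableOn_exp_eq hR (by fun_prop) hne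
  set s : ℂ → ℂ := fun z => Complex.exp (l z / 2) with hs
  have hsd : DifferentiableOn ℂ s (ball c R) := by fun_prop
  have hs2 : ∀ z ∈ ball c R, s z ^ 2 = 1 - h z ^ 2 := by
    intro z hz
    rw [← hexp z hz, hs, ← Complex.exp_nat_mul]
    congr 1
    push_cast
    ring
  have hprod : ∀ z ∈ ball c R, (h z + s z * Complex.I) * (h z - s z * Complex.I) = 1 := by
    intro z hz
    linear_combination hs2 z hz - s z ^ 2 * Complex.I_sq
  obtain ⟨q, hq, -, hqe⟩ := exists_differentiableOn_exp_eq (f := fun z => h z + s z * Complex.I)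
    hR (by fun_prop) (fun z hz => left_ne_zero_of_mul_eq_one (hprod z hz))
  set g : ℂ → ℂ := fun z => -q z * Complex.I with hgdef
  have hgq : ∀ z, g z * Complex.I = q z := fun z => by
    simp only [hgdef]
    linear_combination -q z * Complex.I_sq
  have hneg : ∀ z ∈ ball c R, Complex.exp (-q z) = h z - s z * Complex.I := by
    intro z hz
    rw [Complex.exp_neg, hqe z hz]
    exact inv_eq_of_mul_eq_one_right (hprod z hz)
  have hcos : ∀ z ∈ ball c R, Complex.cos (g z) = h z := by
    intro z hz
    rw [Complex.cos, neg_mul, hgq, hqe z hz, hneg z hz]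
    ring
  have hg : DifferentiableOn ℂ g (ball c R) := by fun_prop
  have hdist := norm_sub_le_of_cos_ne_intCast hR hg
    (fun z hz n => by rw [hcos z hz]; exact hint z hz n)
  have hcR : c ∈ ball c R := mem_ball_self hR
  have hsc : ‖s c‖ ≤ 1 + ‖h c‖ := by
    have h1 : ‖s c‖ ^ 2 ≤ 1 + ‖h c‖ ^ 2 := by
      rw [← norm_pow, hs2 c hcR, ← norm_pow]
      exact (norm_sub_le _ _).trans_eq (by rw [norm_one])
    nlinarith [norm_nonneg (s c), norm_nonneg (h c)]
  have hplus : ‖Complex.exp (q c)‖ ≤ 2 * ‖h c‖ + 1 := by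
    rw [hqe c hcR]
    have := norm_add_le (h c) (s c * Complex.I)
    simp only [norm_mul, Complex.norm_I, mul_one] at this
    linarith
  have hminus : ‖Complex.exp (-q c)‖ ≤ 2 * ‖h c‖ + 1 := by
    rw [hneg c hcR]
    have := norm_sub_le (h c) (s c * Complex.I)
    simp only [norm_mul, Complex.norm_I, mul_one] at this
    linarith
  intro z hz
  have hzR : z ∈ ball c R := ball_subset_ball (by linarith) hz
  have hqd : ‖q z - q c‖ ≤ 1280 := by
    have h1 := hdist z hz
    rwa [hgdef, ← sub_mul, norm_mul, Complex.norm_I, mul_one, neg_sub_neg, norm_sub_rev] at h1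
  have hmul : ∀ u v : ℂ, ‖Complex.exp v‖ ≤ 2 * ‖h c‖ + 1 → ‖u - v‖ ≤ 1280 →
      ‖Complex.exp u‖ ≤ (2 * ‖h c‖ + 1) * Real.exp 1280 := by
    intro u v hv huv
    rw [← add_sub_cancel v u, Complex.exp_add, norm_mul]
    refine mul_le_mul hv ?_ (norm_nonneg _) (by positivity)
    exact (Complex.norm_exp_le_exp_norm _).trans (Real.exp_le_exp.2 huv)
  have h1 := hmul _ _ hplus hqd
  have h2 := hmul (-q z) (-q c) hminus (by rwa [neg_sub_neg, norm_sub_rev])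
  have h3 : h z = (Complex.exp (q z) + Complex.exp (-q z)) / 2 := by
    rw [hqe z hzR, hneg z hzR]
    ring
  rw [h3, norm_div, Complex.norm_ofNat]
  linarith [norm_add_le (Complex.exp (q z)) (Complex.exp (-q z))]

open Metric in
theorem norm_le_of_ne_zero_of_ne_one {f : ℂ → ℂ} {c : ℂ} {R M : ℝ} (hR : 0 < R)
    (hf : DifferentiableOn ℂ f (ball c R)) (h0 : ∀ z ∈ ball c R, f z ≠ 0)
    (h1 : ∀ z ∈ ball c R, f z ≠ 1) (hlow : 1 / 2 ≤ ‖f c‖) (hup : ‖f c‖ ≤ M) :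
    ∀ z ∈ ball c (R / 2),
      ‖f z‖ ≤ Real.exp (2 * Real.pi * ((2 * (M + 1 + Real.pi) + 1) * Real.exp 1280)) := by
  obtain ⟨l, hl, hlc, hexp⟩ := exists_differentiableOn_exp_eq hR hf h0
  have h2pi : 2 * Real.pi * Complex.I ≠ 0 := Complex.two_pi_I_ne_zero
  set h : ℂ → ℂ := fun z => l z / (2 * Real.pi * Complex.I) with hh
  have hlh : ∀ z, l z = 2 * Real.pi * Complex.I * h z := fun z => by
    simp only [hh]
    field_simp
  have hint : ∀ z ∈ ball c R, ∀ n : ℤ, h z ≠ n := by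
    intro z hz n hn
    apply h1 z hz
    rw [← hexp z hz, Complex.exp_eq_one_iff]
    exact ⟨n, by rw [hlh, hn]; ring⟩
  have hnorm : ∀ z, ‖l z‖ = 2 * Real.pi * ‖h z‖ := fun z => by
    rw [hlh z]
    simp [abs_of_pos Real.pi_pos]
  have hlog : |Real.log ‖f c‖| ≤ M + 1 := by
    have hpos : 0 < ‖f c‖ := by linarith
    rw [abs_le]
    constructor
    · have e := Real.one_sub_inv_le_log_of_pos hpos
      have : ‖f c‖⁻¹ ≤ 2 := by
        rw [inv_le_comm₀ hpos (by norm_num)]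
        linarith
      linarith
    · linarith [Real.log_le_sub_one_of_pos hpos]
  have hlc' : ‖l c‖ ≤ M + 1 + Real.pi := by
    rw [hlc]
    refine (Complex.norm_le_abs_re_add_abs_im _).trans ?_
    rw [Complex.log_re, Complex.log_im]
    exact add_le_add hlog (Complex.abs_arg_le_pi _)
  have hhc : ‖h c‖ ≤ M + 1 + Real.pi := by
    rw [hnorm] at hlc'
    nlinarith [norm_nonneg (h c), Real.pi_gt_three]
  intro z hz
  rw [← hexp z (ball_subset_ball (by linarith) hz)]
  refine (Complex.norm_exp_le_exp_norm _).trans (Real.exp_le_exp.2 ?_)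
  rw [hnorm]
  have := norm_le_of_ne_intCast hR (by fun_prop) hint z hz
  gcongr
  exact this.trans (by gcongr)

open Metric in
/-- A version of **Schottky's theorem**. -/
theorem exists_forall_norm_le_of_ne_zero_of_ne_one (M : ℝ) :
    ∃ C : ℝ, ∀ (f : ℂ → ℂ) (c : ℂ) (R : ℝ), 0 < R → DifferentiableOn ℂ f (ball c R) →
      (∀ z ∈ ball c R, f z ≠ 0) → (∀ z ∈ ball c R, f z ≠ 1) → ‖f c‖ ≤ M →
      ∀ z ∈ ball c (R / 2), ‖f z‖ ≤ C := by
  refine ⟨1 + Real.exp (2 * Real.pi * ((2 * (M + 1 + 1 + Real.pi) + 1) * Real.exp 1280)),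
    fun f c R hR hf h0 h1 hM z hz => ?_⟩
  rcases le_total (1 / 2) ‖f c‖ with h | h
  · have := norm_le_of_ne_zero_of_ne_one hR hf h0 h1 h (hM.trans (by linarith : M ≤ M + 1)) z hz
    linarith
  · have hlow : 1 / 2 ≤ ‖1 - f c‖ := by
      have := norm_sub_norm_le (1 : ℂ) (f c)
      rw [norm_one] at this
      linarith
    have hup : ‖1 - f c‖ ≤ M + 1 := by
      have := norm_sub_le (1 : ℂ) (f c)
      rw [norm_one] at this
      linarith
    have h2 := norm_le_of_ne_zero_of_ne_one (f := fun z => 1 - f z) hR (by fun_prop)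
      (fun w hw e => h1 w hw (sub_eq_zero.1 e).symm)
      (fun w hw e => h0 w hw (by simpa using e)) hlow hup z hz
    have h3 := norm_sub_le (1 : ℂ) (1 - f z)
    rw [norm_one, sub_sub_cancel] at h3
    linarith

open Metric in
/-- A version of **Montel's theorem** for uniformly bounded sequences. -/
theorem exists_subseq_tendstoUniformlyOn {f : ℕ → ℂ → ℂ} {c : ℂ} {r M : ℝ} (hr : 0 < r)
    (hf : ∀ n, DifferentiableOn ℂ (f n) (ball c r)) (hM : ∀ n, ∀ z ∈ ball c r, ‖f n z‖ ≤ M) :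
    ∃ φ : ℕ → ℕ, StrictMono φ ∧ ∃ g : ℂ → ℂ,
      TendstoUniformlyOn (fun n => f (φ n)) g atTop (closedBall c (r / 8)) := by
  set K := closedBall c (r / 8)
  have hKsub : K ⊆ ball c r := closedBall_subset_ball (by linarith)
  have : CompactSpace K := isCompact_iff_compactSpace.1 (isCompact_closedBall _ _)
  let F : ℕ → BoundedContinuousFunction K ℂ := fun n =>
    BoundedContinuousFunction.mkOfCompact ⟨K.domRestrict (f n),
      ((hf n).continuousOn.mono hKsub).domRestrict⟩
  have hF : ∀ n x, F n x = f n x := fun n x => rfl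
  have hdist : ∀ n (x y : K), dist (f n x) (f n y) ≤ 2 * M / (r / 2) * dist x y := by
    intro n x y
    have hx := mem_closedBall.1 x.2
    have hy := mem_closedBall.1 y.2
    have hsub : ball (y : ℂ) (r / 2) ⊆ ball c r := ball_subset_ball' (by linarith)
    refine Complex.dist_le_div_mul_dist_of_mapsTo_ball ((hf n).mono hsub) ?_ ?_
    · intro z hz
      rw [mem_closedBall, dist_eq_norm]
      linarith [norm_sub_le (f n z) (f n y), hM n z (hsub hz), hM n y (hKsub y.2)]
    · rw [mem_ball]
      linarith [dist_triangle_right (x : ℂ) y c]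
  have hcomp : IsCompact (closure (Set.range F)) := by
    refine BoundedContinuousFunction.arzela_ascoli (closedBall (0 : ℂ) M)
      (isCompact_closedBall _ _) _ ?_ ?_
    · rintro _ x ⟨n, rfl⟩
      simpa [hF] using hM n x (hKsub x.2)
    · refine Metric.equicontinuous_of_continuity_modulus
        (fun t => 2 * M / (r / 2) * t) ?_ _ ?_
      · exact (by fun_prop : Continuous fun t : ℝ => 2 * M / (r / 2) * t).tendsto' 0 0 (by simp)
      · rintro x y ⟨_, n, rfl⟩
        exact hdist n x y
  obtain ⟨G, -, φ, hφ, hG⟩ := hcomp.tendsto_subseq (x := F)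
    (fun n => subset_closure (Set.mem_range_self n))
  refine ⟨φ, hφ, Function.extend Subtype.val G 0, ?_⟩
  rw [BoundedContinuousFunction.tendsto_iff_tendstoUniformly] at hG
  rw [tendstoUniformlyOn_iff_tendstoUniformly_comp_coe]
  have hcomp_val : Function.extend Subtype.val G 0 ∘ Subtype.val = G :=
    funext fun x => Subtype.val_injective.extend_apply G 0 x
  rw [hcomp_val]
  have hFφ : (fun n (x : K) => f (φ n) x) = fun n => ⇑((F ∘ φ) n) :=
    funext fun n => funext fun x => (hF (φ n) x).symm
  rw [hFφ]
  exact hG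

/-- If `z₀` is in the Julia like set of `𝓕` and `N ⊆ D` is a
neighborhood of `z₀`, then the complement of `U = ⋃_{f ∈ 𝓕} f(N)` contains
at most one point. -/
theorem compl_union_image_subsingleton (D : Set ℂ) (hD : IsOpen D)
    (hDconn : IsConnected D) (𝓕 : Set (ℂ → ℂ))
    (hol : ∀ f ∈ 𝓕, DifferentiableOn ℂ f D)
    (z₀ : ℂ) (hz₀ : z₀ ∈ juliaLike 𝓕 D)
    (N : Set ℂ) (hN : N ∈ 𝓝 z₀) (hND : N ⊆ D) :
    (⋃ f ∈ 𝓕, f '' N)ᶜ.Subsingleton := by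
  intro a ha b hb
  by_contra hab
  have homit : ∀ v ∈ (⋃ f ∈ 𝓕, f '' N)ᶜ, ∀ f ∈ 𝓕, ∀ z ∈ N, f z ≠ v := by
    intro v hv f hf z hz hfz
    exact hv (Set.mem_biUnion hf ⟨z, hz, hfz⟩)
  refine hz₀.2 ⟨hz₀.1, ?_⟩
  obtain ⟨r, hr, hrN⟩ := Metric.mem_nhds_iff.1 hN
  set U := Metric.ball z₀ (r / 16)
  have hUr : U ⊆ Metric.ball z₀ r := Metric.ball_subset_ball (by linarith)
  refine ⟨U, Metric.isOpen_ball, Metric.mem_ball_self (by linarith), hUr.trans (hrN.trans hND),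
    fun f hf => ?_⟩
  have hba : b - a ≠ 0 := sub_ne_zero.2 (Ne.symm hab)
  set g : ℕ → ℂ → ℂ := fun n z => (f n z - a) / (b - a) with hg
  have hfd : ∀ n, DifferentiableOn ℂ (f n) (Metric.ball z₀ r) :=
    fun n => (hol _ (hf n)).mono (hrN.trans hND)
  have hgd : ∀ n, DifferentiableOn ℂ (g n) (Metric.ball z₀ r) :=
    fun n => ((hfd n).sub_const a).div_const _
  have hg0 : ∀ n, ∀ z ∈ Metric.ball z₀ r, g n z ≠ 0 := fun n z hz =>
    div_ne_zero (sub_ne_zero.2 (homit a ha _ (hf n) z (hrN hz))) hba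
  have hg1 : ∀ n, ∀ z ∈ Metric.ball z₀ r, g n z ≠ 1 := fun n z hz h =>
    homit b hb _ (hf n) z (hrN hz) (sub_left_injective ((div_eq_one_iff_eq hba).1 h))
  have hfg : ∀ n z, f n z = (b - a) * g n z + a := fun n z => by
    rw [hg, mul_div_cancel₀ _ hba, sub_add_cancel]
  by_cases hbdd : ∃ M : ℝ, ∃ᶠ n in atTop, ‖g n z₀‖ ≤ M
  · obtain ⟨M, hM⟩ := hbdd
    obtain ⟨ψ, hψ, hψM⟩ := extraction_of_frequently_atTop hM
    obtain ⟨C, hC⟩ := exists_forall_norm_le_of_ne_zero_of_ne_one M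
    have hr2 : Metric.ball z₀ (r / 2) ⊆ Metric.ball z₀ r := Metric.ball_subset_ball (by linarith)
    obtain ⟨φ, hφ, h, hh⟩ := exists_subseq_tendstoUniformlyOn (f := fun n => f (ψ n))
      (M := ‖b - a‖ * C + ‖a‖) (half_pos hr) (fun n => (hfd _).mono hr2) (fun n z hz => by
        rw [hfg]
        refine (norm_add_le _ _).trans ?_
        rw [norm_mul]
        gcongr
        exact hC _ _ _ hr (hgd _) (hg0 _) (hg1 _) (hψM n) z hz)
    have hloc : TendstoLocallyUniformlyOn (fun n => f (ψ (φ n))) h atTop U := by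
      refine (hh.mono ?_).tendstoLocallyUniformlyOn
      exact Metric.ball_subset_closedBall.trans (Metric.closedBall_subset_closedBall (by linarith))
    exact ⟨ψ ∘ φ, hψ.comp hφ, Or.inl ⟨h, hloc.differentiableOn
      (Eventually.of_forall fun n => (hfd _).mono hUr) Metric.isOpen_ball, hloc⟩⟩
  · push Not at hbdd
    refine ⟨id, strictMono_id, Or.inr fun M K hK _ => ?_⟩
    obtain ⟨C, hC⟩ := exists_forall_norm_le_of_ne_zero_of_ne_one ((M + ‖a‖) / ‖b - a‖)
    filter_upwards [hbdd C] with n hn z hz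
    by_contra! hlt
    have hzU := Metric.mem_ball.1 (hK hz)
    have hsub : Metric.ball z (r / 2) ⊆ Metric.ball z₀ r := Metric.ball_subset_ball' (by linarith)
    refine hn.not_ge (hC (g n) z (r / 2) (half_pos hr) ((hgd n).mono hsub)
      (fun w hw => hg0 n w (hsub hw)) (fun w hw => hg1 n w (hsub hw)) ?_ z₀ ?_)
    · rw [hg, norm_div]
      gcongr
      exact (norm_sub_le _ _).trans (add_le_add_left hlt.le _)
    · rw [Metric.mem_ball, dist_comm]
      linarith
end

section
/- Let D ⊆ ℂ be a domain and 𝓕 a family of holomorphic functions on D. If the Julia like set J(𝓕) is forward invariant under 𝓕, then either J(𝓕) = D or J(𝓕) has empty interior. -/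
open Filter Topology

open Metric in
/-- A holomorphic function omitting `0` on a disc is there the exponential of a holomorphic
function whose value at the centre is the principal logarithm. -/
lemma exists_log_on_ball {h : ℂ → ℂ} {c : ℂ} {R : ℝ} (hR : 0 < R)
    (hd : DifferentiableOn ℂ h (ball c R)) (h0 : ∀ z ∈ ball c R, h z ≠ 0) :
    ∃ L : ℂ → ℂ, DifferentiableOn ℂ L (ball c R) ∧ L c = Complex.log (h c) ∧
      ∀ z ∈ ball c R, Complex.exp (L z) = h z := by
  have hc : c ∈ ball c R := mem_ball_self hR
  obtain ⟨P, hP⟩ := ((hd.deriv isOpen_ball).div hd h0).isExactOn_ball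
  have hL : ∀ z ∈ ball c R, HasDerivAt (fun z => P z - P c + Complex.log (h c))
      (deriv h z / h z) z := fun z hz => ((hP z hz).sub_const _).add_const _
  refine ⟨fun z => P z - P c + Complex.log (h c),
    fun z hz => (hL z hz).differentiableAt.differentiableWithinAt, by simp, fun z hz => ?_⟩
  have hq : ∀ w ∈ ball c R, HasDerivAt
      (fun z => Complex.exp (-(P z - P c + Complex.log (h c))) * h z) 0 w := by
    intro w hw
    have h1 := (hL w hw).neg.cexp.mul
      ((hd.differentiableAt (isOpen_ball.mem_nhds hw)).hasDerivAt)
    refine h1.congr_deriv ?_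
    rw [mul_assoc, neg_mul, div_mul_cancel₀ _ (h0 w hw)]
    ring
  have hconst := isOpen_ball.is_const_of_deriv_eq_zero (convex_ball c R).isPreconnected
    (fun w hw => (hq w hw).differentiableAt.differentiableWithinAt)
    (fun w hw => (hq w hw).deriv) hz hc
  simp only [sub_self, zero_add, Complex.exp_neg, Complex.exp_log (h0 c hc)] at hconst
  rw [inv_mul_cancel₀ (h0 c hc), inv_mul_eq_one₀ (Complex.exp_ne_zero _)] at hconst
  exact hconst

open Metric in
/-- A Harnack type inequality for holomorphic functions of modulus at least `1`. -/
lemma log_norm_le_of_one_le_norm {h : ℂ → ℂ} {c w : ℂ} {R : ℝ} (hR : 0 < R)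
    (hd : DifferentiableOn ℂ h (ball c R)) (h1 : ∀ z ∈ ball c R, 1 ≤ ‖h z‖)
    (hw : dist w c ≤ R / 2) :
    Real.log ‖h w‖ ≤ 2 + 3 * (Real.log ‖h c‖ + Real.pi) := by
  have h0 : ∀ z ∈ ball c R, h z ≠ 0 := fun z hz => norm_pos_iff.1 (one_pos.trans_le (h1 z hz))
  obtain ⟨L, hLd, hLc, hLe⟩ := exists_log_on_ball hR hd h0
  have hre : ∀ z ∈ ball c R, (L z).re = Real.log ‖h z‖ := fun z hz => by
    rw [← hLe z hz, Complex.norm_exp, Real.log_exp]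
  have hmaps : Set.MapsTo (fun u => c + u) (ball (0 : ℂ) R) (ball c R) := fun u hu => by
    simpa using hu
  have hwR : ‖w - c‖ ≤ R / 2 := by rwa [← dist_eq_norm]
  have hwb : w - c ∈ ball (0 : ℂ) R := by
    rw [mem_ball_zero_iff]
    linarith
  have hwc : w ∈ ball c R := by simpa using hmaps hwb
  have key := Complex.borelCaratheodory (f := fun u => -L (c + u)) (M := 1) one_pos
    (hLd.comp (by fun_prop) hmaps).neg
    (fun u hu => by
      have := Real.log_nonneg (h1 _ (hmaps hu))
      simp only [Set.mem_ofPred_eq, Complex.neg_re, hre _ (hmaps hu)]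
      linarith) hR hwb
  simp only [add_sub_cancel, add_zero, norm_neg] at key
  have hL0 : ‖L c‖ ≤ Real.log ‖h c‖ + Real.pi := by
    have hlog := Real.log_nonneg (h1 c (mem_ball_self hR))
    calc ‖L c‖ ≤ |(L c).re| + |(L c).im| := Complex.norm_le_abs_re_add_abs_im _
      _ ≤ _ := by
        rw [hLc, Complex.log_re, Complex.log_im, abs_of_nonneg hlog]
        gcongr
        exact Complex.abs_arg_le_pi _
  have hpos : 0 < R - ‖w - c‖ := by linarith
  have e1 : 2 * 1 * ‖w - c‖ / (R - ‖w - c‖) ≤ 2 := by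
    rw [div_le_iff₀ hpos]
    linarith
  have e2 : ‖L c‖ * (R + ‖w - c‖) / (R - ‖w - c‖) ≤ 3 * ‖L c‖ := by
    rw [div_le_iff₀ hpos]
    nlinarith [norm_nonneg (L c)]
  rw [← hre w hwc]
  linarith [(le_abs_self _).trans (Complex.abs_re_le_norm (L w))]

open Metric in
/-- **Montel's theorem** for a uniformly bounded sequence of holomorphic functions on a disc. -/
lemma exists_subseq_tendstoLocallyUniformlyOn_ball {f : ℕ → ℂ → ℂ} {c : ℂ} {ρ M : ℝ}
    (hρ : 0 < ρ) (hd : ∀ n, DifferentiableOn ℂ (f n) (ball c (2 * ρ)))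
    (hM : ∀ n, ∀ z ∈ ball c (2 * ρ), ‖f n z‖ ≤ M) :
    ∃ φ : ℕ → ℕ, StrictMono φ ∧ ∃ g : ℂ → ℂ, DifferentiableOn ℂ g (ball c ρ) ∧
      TendstoLocallyUniformlyOn (fun n => f (φ n)) g atTop (ball c ρ) := by
  have hsub : closedBall c ρ ⊆ ball c (2 * ρ) := closedBall_subset_ball (by linarith)
  have : CompactSpace (closedBall c ρ) := isCompact_iff_compactSpace.1 (isCompact_closedBall c ρ)
  let F : ℕ → BoundedContinuousFunction (closedBall c ρ) ℂ := fun n =>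
    BoundedContinuousFunction.mkOfCompact
      ⟨(closedBall c ρ).domRestrict (f n), ((hd n).continuousOn.mono hsub).domRestrict⟩
  have hF : ∀ n x, F n x = f n x := fun n x => rfl
  have hlip : ∀ n, ∀ z ∈ closedBall c ρ, ∀ w ∈ ball z ρ,
      dist (f n w) (f n z) ≤ 2 * M / ρ * dist w z := by
    intro n z hz w hw
    have hzb : ball z ρ ⊆ ball c (2 * ρ) := ball_subset_ball' (by
      rw [mem_closedBall] at hz
      linarith)
    refine Complex.dist_le_div_mul_dist_of_mapsTo_ball ((hd n).mono hzb) (fun u hu => ?_) hw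
    rw [mem_closedBall, dist_eq_norm]
    linarith [norm_sub_le (f n u) (f n z), hM n u (hzb hu), hM n z (hsub hz)]
  have hcomp := BoundedContinuousFunction.arzela_ascoli (closedBall (0 : ℂ) M)
    (isCompact_closedBall 0 M) (Set.range F)
    (by
      rintro _ x ⟨n, rfl⟩
      simpa [hF] using hM n x (hsub x.2))
    (by
      intro x
      rw [Metric.equicontinuousAt_iff_right]
      intro ε hε
      have hlim : Tendsto (fun y : closedBall c ρ => 2 * M / ρ * dist (y : ℂ) x) (𝓝 x) (𝓝 0) := by
        have : Continuous (fun y : closedBall c ρ => 2 * M / ρ * dist (y : ℂ) x) := by fun_prop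
        simpa using this.tendsto x
      filter_upwards [hlim.eventually (gt_mem_nhds hε), ball_mem_nhds x hρ] with y hy hyx
      rintro ⟨_, n, rfl⟩
      rw [dist_comm]
      exact (hlip n x x.2 y hyx).trans_lt hy)
  obtain ⟨G, -, φ, hφ, hG⟩ := hcomp.tendsto_subseq (x := F)
    (fun n => subset_closure (Set.mem_range_self n))
  rw [BoundedContinuousFunction.tendsto_iff_tendstoUniformly] at hG
  classical
  let g : ℂ → ℂ := fun z => if hz : z ∈ closedBall c ρ then G ⟨z, hz⟩ else 0
  have hunif : TendstoUniformlyOn (fun n => f (φ n)) g atTop (closedBall c ρ) := by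
    rw [Metric.tendstoUniformlyOn_iff]
    intro ε hε
    filter_upwards [Metric.tendstoUniformly_iff.1 hG ε hε] with n hn z hz
    have hgz : g z = G ⟨z, hz⟩ := dif_pos hz
    rw [hgz]
    exact hn ⟨z, hz⟩
  have hloc := (hunif.mono ball_subset_closedBall).tendstoLocallyUniformlyOn
  exact ⟨φ, hφ, g, hloc.differentiableOn (Eventually.of_forall fun n =>
    (hd (φ n)).mono (ball_subset_closedBall.trans hsub)) isOpen_ball, hloc⟩

open Metric in
/-- A sequence of holomorphic functions on a disc, all omitting the same disc of values, has a
subsequence converging locally uniformly, possibly to `∞`, on a smaller concentric disc. -/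
lemma exists_subseq_of_omits_ball {f : ℕ → ℂ → ℂ} {c a : ℂ} {ρ r : ℝ} (hρ : 0 < ρ) (hr : 0 < r)
    (hd : ∀ n, DifferentiableOn ℂ (f n) (ball c (4 * ρ)))
    (hf : ∀ n, ∀ z ∈ ball c (4 * ρ), r ≤ ‖f n z - a‖) :
    ∃ φ : ℕ → ℕ, StrictMono φ ∧
      ((∃ g : ℂ → ℂ, DifferentiableOn ℂ g (ball c ρ) ∧
          TendstoLocallyUniformlyOn (fun n => f (φ n)) g atTop (ball c ρ)) ∨
        TendstoInftyLocallyUniformlyOn (fun n => f (φ n)) (ball c ρ)) := by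
  let h : ℕ → ℂ → ℂ := fun n z => (f n z - a) / r
  have hnorm : ∀ n z, ‖h n z‖ = ‖f n z - a‖ / r := fun n z => by
    simp [h, abs_of_pos hr]
  have hhd : ∀ n, DifferentiableOn ℂ (h n) (ball c (4 * ρ)) := fun n =>
    ((hd n).sub_const a).div_const _
  have hh1 : ∀ n, ∀ z ∈ ball c (4 * ρ), 1 ≤ ‖h n z‖ := fun n z hz => by
    rw [hnorm, one_le_div hr]
    exact hf n z hz
  by_cases ht : Tendsto (fun n => Real.log ‖h n c‖) atTop atTop
  · refine ⟨id, strictMono_id, Or.inr fun M K hK _ => ?_⟩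
    let B := (M + ‖a‖) / r
    filter_upwards [ht.eventually_gt_atTop (2 + 3 * (Real.log (max B 1) + Real.pi))]
      with n hn z hz
    have hzc : dist z c < ρ := hK hz
    have hzb : ball z (2 * ρ) ⊆ ball c (4 * ρ) := ball_subset_ball' (by linarith)
    have key := log_norm_le_of_one_le_norm (w := c) (by positivity : 0 < 2 * ρ)
      ((hhd n).mono hzb) (fun u hu => hh1 n u (hzb hu)) (by rw [dist_comm]; linarith)
    have hlog : Real.log (max B 1) < Real.log ‖h n z‖ := by linarith
    have hlt := (Real.log_lt_log_iff (by positivity)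
      (one_pos.trans_le (hh1 n z (hzb (mem_ball_self (by positivity)))))).1 hlog
    have hB : B ≤ ‖h n z‖ := (le_max_left _ _).trans hlt.le
    rw [hnorm, div_le_div_iff_of_pos_right hr] at hB
    have := norm_sub_le (f n z) a
    simp only [id]
    linarith
  · rw [Filter.tendsto_atTop] at ht
    push Not at ht
    obtain ⟨B, hB⟩ := ht
    obtain ⟨φ, hφ, hφB⟩ := extraction_of_frequently_atTop hB
    have hsub : ball c (2 * ρ) ⊆ ball c (4 * ρ) := ball_subset_ball (by linarith)
    obtain ⟨ψ, hψ, hg⟩ := exists_subseq_tendstoLocallyUniformlyOn_ball (f := fun n => f (φ n))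
      (M := Real.exp (2 + 3 * (B + Real.pi)) * r + ‖a‖) hρ (fun n => (hd _).mono hsub)
      (fun n z hz => by
        have key := log_norm_le_of_one_le_norm (w := z) (by positivity : 0 < 4 * ρ)
          (hhd (φ n)) (hh1 (φ n)) (by
            rw [mem_ball] at hz
            linarith)
        have hle : Real.log ‖h (φ n) z‖ ≤ 2 + 3 * (B + Real.pi) := by linarith [hφB n]
        rw [Real.log_le_iff_le_exp (one_pos.trans_le (hh1 _ z (hsub hz))), hnorm,
          div_le_iff₀ hr] at hle
        have := norm_sub_norm_le (f (φ n) z) a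
        linarith)
    exact ⟨φ ∘ ψ, hφ.comp hψ, Or.inl hg⟩

lemma isOpen_fatouLike (𝓕 : Set (ℂ → ℂ)) (D : Set ℂ) : IsOpen (fatouLike 𝓕 D) := by
  rw [isOpen_iff_mem_nhds]
  rintro z ⟨-, U, hU, hzU, hUD, hseq⟩
  exact mem_of_superset (hU.mem_nhds hzU) fun w hw => ⟨hUD hw, U, hU, hw, hUD, hseq⟩

/-- If the Julia like set of `𝓕` is forward invariant under `𝓕`,
then it is all of `D` or has empty interior. -/
theorem juliaLike_eq_or_interior_empty (D : Set ℂ) (hD : IsOpen D)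
    (hDconn : IsConnected D) (𝓕 : Set (ℂ → ℂ))
    (hol : ∀ f ∈ 𝓕, DifferentiableOn ℂ f D)
    (hFwd : ∀ f ∈ 𝓕, f '' juliaLike 𝓕 D ⊆ juliaLike 𝓕 D) :
    juliaLike 𝓕 D = D ∨ interior (juliaLike 𝓕 D) = ∅ := by
  by_contra! hne
  obtain ⟨hJ, c, hc⟩ := hne
  have hJD : juliaLike 𝓕 D ⊆ D := Set.sdiff_subset
  obtain ⟨a, haF⟩ : (fatouLike 𝓕 D).Nonempty := by
    rw [Set.nonempty_iff_ne_empty]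
    intro hF
    exact hJ (by rw [juliaLike, hF, Set.sdiff_empty])
  obtain ⟨r, hr, har⟩ := Metric.isOpen_iff.1 (isOpen_fatouLike 𝓕 D) a haF
  obtain ⟨R, hR, hcR⟩ := Metric.isOpen_iff.1 isOpen_interior c hc
  have hball : Metric.ball c (4 * (R / 4)) ⊆ juliaLike 𝓕 D := by
    rw [mul_div_cancel₀ R (by norm_num)]
    exact hcR.trans interior_subset
  have hsub : Metric.ball c (R / 4) ⊆ Metric.ball c (4 * (R / 4)) :=
    Metric.ball_subset_ball (by linarith)
  have hcJ := interior_subset hc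
  refine hcJ.2 ⟨hcJ.1, Metric.ball c (R / 4), Metric.isOpen_ball,
    Metric.mem_ball_self (by positivity), hsub.trans (hball.trans hJD), fun f hf => ?_⟩
  refine exists_subseq_of_omits_ball (a := a) (by positivity) hr
    (fun n => (hol _ (hf n)).mono (hball.trans hJD)) fun n z hz => ?_
  by_contra! hlt
  rw [← dist_eq_norm] at hlt
  exact (hFwd _ (hf n) ⟨z, hball hz, rfl⟩).2 (har hlt)
end

section
/- Let D ⊆ ℂ be a domain whose complement ℂ \ D contains at least two points, and let 𝓕 be a family of holomorphic functions on D such that J(𝓕) is forward invariant under 𝓕. Then J(𝓕) has empty interior. -/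
open Filter Topology

section

open Metric Set

theorem exists_log_of_ne_zero_on_ball {F : ℂ → ℂ} {c : ℂ} {R : ℝ} (hR : 0 < R)
    (hF : DifferentiableOn ℂ F (ball c R)) (h0 : ∀ z ∈ ball c R, F z ≠ 0) :
    ∃ L : ℂ → ℂ, DifferentiableOn ℂ L (ball c R) ∧ L c = Complex.log (F c) ∧
      ∀ z ∈ ball c R, Complex.exp (L z) = F z := by
  have hc : c ∈ ball c R := mem_ball_self hR
  have hq : DifferentiableOn ℂ (fun z => deriv F z / F z) (ball c R) :=
    (hF.deriv isOpen_ball).div hF h0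
  obtain ⟨L, hLc, hL⟩ := hq.isExactOn_ball.with_val_at c (Complex.log (F c))
  refine ⟨L, fun z hz => (hL z hz).differentiableAt.differentiableWithinAt, hLc, fun z hz => ?_⟩
  have hd : ∀ w ∈ ball c R, HasDerivAt (fun w => F w * Complex.exp (-L w)) 0 w := by
    intro w hw
    have h1 := (hF.differentiableAt (isOpen_ball.mem_nhds hw)).hasDerivAt
    refine (h1.mul (hL w hw).neg.cexp).congr_deriv ?_
    have := h0 w hw
    field_simp
    ring
  have hconst := (convex_ball c R).is_const_of_fderivWithin_eq_zero (𝕜 := ℂ)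
    (f := fun w => F w * Complex.exp (-L w))
    (fun w hw => (hd w hw).differentiableAt.differentiableWithinAt)
    (fun w hw => by
      rw [fderivWithin_of_isOpen isOpen_ball hw]
      ext
      simpa using (hd w hw).deriv) hz hc
  simp only [hLc, Complex.exp_neg, Complex.exp_log (h0 c hc)] at hconst
  rw [mul_inv_cancel₀ (h0 c hc)] at hconst
  exact (mul_inv_eq_one₀ (Complex.exp_ne_zero _)).1 hconst |>.symm

theorem exists_cos_pi_mul_eq_on_ball {F : ℂ → ℂ} {c : ℂ} {R : ℝ} (hR : 0 < R)
    (hF : DifferentiableOn ℂ F (ball c R)) (h1 : ∀ z ∈ ball c R, F z ≠ 1)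
    (h2 : ∀ z ∈ ball c R, F z ≠ -1) :
    ∃ G : ℂ → ℂ, DifferentiableOn ℂ G (ball c R) ∧
      (∀ z ∈ ball c R, Complex.cos (Real.pi * G z) = F z) ∧ ‖G c‖ ≤ 2 * ‖F c‖ + 1 := by
  have hc : c ∈ ball c R := mem_ball_self hR
  obtain ⟨P, hPd, -, hP⟩ := exists_log_of_ne_zero_on_ball (F := fun z => F z ^ 2 - 1) hR
    ((hF.pow 2).sub_const 1) (fun z hz h => by
      rcases sq_eq_one_iff.1 (sub_eq_zero.1 h) with h | h
      exacts [h1 z hz h, h2 z hz h])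
  set H : ℂ → ℂ := fun z => Complex.exp (P z / 2) with hH
  have hHd : DifferentiableOn ℂ H (ball c R) := (hPd.div_const 2).cexp
  have hHsq : ∀ z ∈ ball c R, H z ^ 2 = F z ^ 2 - 1 := by
    intro z hz
    rw [← hP z hz, hH, ← Complex.exp_nat_mul]
    congr 1
    push_cast
    ring
  have hmul : ∀ z ∈ ball c R, (F z + H z) * (F z - H z) = 1 := by
    intro z hz
    linear_combination -hHsq z hz
  have hne : ∀ z ∈ ball c R, F z + H z ≠ 0 := fun z hz h => by
    simpa [h] using hmul z hz
  obtain ⟨L, hLd, hLc, hL⟩ := exists_log_of_ne_zero_on_ball hR (hF.add hHd) hne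
  simp only [Pi.add_apply] at hLc hL
  have hpi : (Real.pi : ℂ) ≠ 0 := Complex.ofReal_ne_zero.2 Real.pi_ne_zero
  refine ⟨fun z => -Complex.I * L z / Real.pi, (hLd.const_mul _).div_const _, ?_, ?_⟩
  · intro z hz
    have e1 : Real.pi * (-Complex.I * L z / Real.pi) * Complex.I = L z := by
      field_simp
      linear_combination (-L z) * Complex.I_sq
    rw [Complex.cos, neg_mul, e1, Complex.exp_neg, hL z hz,
      inv_eq_of_mul_eq_one_right (hmul z hz)]
    ring
  · have hHn : ‖H c‖ ≤ ‖F c‖ + 1 := by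
      have h : ‖H c‖ ^ 2 ≤ ‖F c‖ ^ 2 + 1 := by
        rw [← norm_pow, hHsq c hc, ← norm_pow]
        exact (norm_sub_le _ _).trans (by simp)
      nlinarith [norm_nonneg (H c), norm_nonneg (F c)]
    have hw : ‖F c + H c‖ ≤ 2 * ‖F c‖ + 1 := (norm_add_le _ _).trans (by linarith)
    have hw' : ‖F c + H c‖⁻¹ ≤ 2 * ‖F c‖ + 1 := by
      rw [← norm_inv, inv_eq_of_mul_eq_one_right (hmul c hc)]
      exact (norm_sub_le _ _).trans (by linarith)
    have hpos : 0 < ‖F c + H c‖ := norm_pos_iff.2 (hne c hc)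
    have hl1 := Real.log_le_sub_one_of_pos hpos
    have hl2 := Real.log_le_sub_one_of_pos (inv_pos.2 hpos)
    rw [Real.log_inv] at hl2
    have hre : |(L c).re| ≤ 2 * ‖F c‖ := by
      rw [hLc, Complex.log_re, abs_le]
      constructor <;> linarith
    have him : |(L c).im| ≤ Real.pi := by
      rw [hLc, Complex.log_im]
      exact Complex.abs_arg_le_pi _
    have hLn := Complex.norm_le_abs_re_add_abs_im (L c)
    have hpi3 := Real.pi_gt_three
    simp only [norm_div, norm_mul, norm_neg, Complex.norm_I, one_mul, Complex.norm_real,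
      Real.norm_eq_abs, abs_of_pos Real.pi_pos]
    rw [div_le_iff₀ Real.pi_pos]
    nlinarith [norm_nonneg (F c)]

theorem exists_cos_pi_mul_eq_intCast_near (w : ℂ) :
    ∃ u : ℂ, ‖u - w‖ < 2 ∧ ∃ m : ℤ, Complex.cos (Real.pi * u) = m := by
  have hpi3 := Real.pi_gt_three
  have key : ∀ y : ℝ, 0 ≤ y → ∃ t : ℝ, |t - y| ≤ 1 ∧ ∃ m : ℤ, Real.cosh (Real.pi * t) = m := by
    intro y hy
    have hgrow : Real.cosh (Real.pi * y) + 1 ≤ Real.cosh (Real.pi * (y + 1)) := by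
      rw [mul_add, mul_one, Real.cosh_add]
      have h1 := Real.one_le_cosh (Real.pi * y)
      have h2 : 0 ≤ Real.sinh (Real.pi * y) := Real.sinh_nonneg_iff.2 (by positivity)
      have h3 : Real.pi ≤ Real.sinh Real.pi := Real.self_le_sinh_iff.2 Real.pi_pos.le
      have h4 := Real.sinh_lt_cosh Real.pi
      nlinarith [mul_nonneg h2 (by linarith : 0 ≤ Real.sinh Real.pi)]
    obtain ⟨t, ht, hte⟩ := intermediate_value_Icc (by linarith : y ≤ y + 1)
      (f := fun t => Real.cosh (Real.pi * t)) (by fun_prop)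
      (show (⌈Real.cosh (Real.pi * y)⌉ : ℝ) ∈ _ from
        ⟨Int.le_ceil _, (Int.ceil_lt_add_one _).le.trans hgrow⟩)
    exact ⟨t, abs_le.2 ⟨by linarith [ht.1], by linarith [ht.2]⟩, _, hte⟩
  have key' : ∃ t : ℝ, |t - w.im| ≤ 1 ∧ ∃ m : ℤ, Real.cosh (Real.pi * t) = m := by
    rcases le_total 0 w.im with h | h
    · exact key _ h
    · obtain ⟨t, ht, m, hm⟩ := key (-w.im) (by linarith)
      refine ⟨-t, ?_, m, ?_⟩
      · rw [← abs_neg]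
        convert ht using 2
        ring
      · rw [mul_neg, Real.cosh_neg, hm]
  obtain ⟨t, ht, m, hm⟩ := key'
  set n : ℤ := round w.re with hn
  refine ⟨n + t * Complex.I, ?_, ?_⟩
  · have h1 : |(n : ℝ) - w.re| ≤ 1 / 2 := by
      rw [abs_sub_comm]
      exact abs_sub_round _
    refine (Complex.norm_le_abs_re_add_abs_im _).trans_lt ?_
    simp only [Complex.sub_re, Complex.add_re, Complex.sub_im, Complex.add_im, Complex.mul_re,
      Complex.mul_im, Complex.intCast_re, Complex.intCast_im, Complex.ofReal_re,
      Complex.ofReal_im, Complex.I_re, Complex.I_im]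
    ring_nf at h1 ht ⊢
    linarith
  · have e : (Real.pi : ℂ) * (n + t * Complex.I) = n * Real.pi + (Real.pi * t : ℝ) * Complex.I := by
      push_cast
      ring
    have hs : Complex.sin (n * Real.pi) = 0 := Complex.sin_int_mul_pi n
    have hcs : Complex.cos (n * Real.pi) = ((-1) ^ n : ℝ) := by
      rw [← Real.cos_int_mul_pi]
      push_cast
      rfl
    rw [e, Complex.cos_add, hs, hcs, Complex.cos_mul_I, ← Complex.ofReal_cosh, hm]
    rcases Int.even_or_odd n with h | h
    · exact ⟨m, by simp [h.neg_one_zpow]⟩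
    · exact ⟨-m, by simp [h.neg_one_zpow]⟩

theorem Complex.norm_cos_le_exp_norm (z : ℂ) : ‖Complex.cos z‖ ≤ Real.exp ‖z‖ := by
  rw [Complex.cos, norm_div]
  have h1 := Complex.norm_exp_le_exp_norm (z * Complex.I)
  have h2 := Complex.norm_exp_le_exp_norm (-z * Complex.I)
  simp only [norm_mul, norm_neg, Complex.norm_I, mul_one] at h1 h2
  have h3 := norm_add_le (Complex.exp (z * Complex.I)) (Complex.exp (-z * Complex.I))
  simp only [Complex.norm_ofNat]
  linarith

theorem ball_subset_image_of_norm_deriv_le {g : ℂ → ℂ} {a : ℂ} {r : ℝ} (hr : 0 < r)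
    (hg : DifferentiableOn ℂ g (ball a r)) (h0 : deriv g a ≠ 0)
    (hle : ∀ z ∈ ball a r, ‖deriv g z‖ ≤ 2 * ‖deriv g a‖) :
    ball (g a) (r * ‖deriv g a‖ / 24) ⊆ g '' ball a r := by
  set A := ‖deriv g a‖ with hA
  have hApos : 0 < A := norm_pos_iff.2 h0
  have hsub : closedBall a (r / 6) ⊆ ball a r := closedBall_subset_ball (by linarith)
  have hmaps : MapsTo (deriv g) (ball a r) (closedBall (deriv g a) (3 * A)) := by
    intro z hz
    rw [mem_closedBall, dist_eq_norm]
    exact (norm_sub_le _ _).trans (by linarith [hle z hz])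
  have hD : ∀ z ∈ closedBall a (r / 6), ‖deriv g z - deriv g a‖ ≤ A / 2 := by
    intro z hz
    have h := Complex.dist_le_div_mul_dist_of_mapsTo_ball (hg.deriv isOpen_ball) hmaps (hsub hz)
    rw [dist_eq_norm] at h
    refine h.trans ?_
    calc 3 * A / r * dist z a ≤ 3 * A / r * (r / 6) := by
          gcongr
          exact hz
      _ = A / 2 := by field_simp; norm_num
  have hgat : ∀ z ∈ closedBall a (r / 6), DifferentiableAt ℂ g z := fun z hz =>
    hg.differentiableAt (isOpen_ball.mem_nhds (hsub hz))
  have hlow : ∀ z ∈ sphere a (r / 6), r * A / 12 ≤ ‖g z - g a‖ := by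
    intro z hz
    have hz' := sphere_subset_closedBall hz
    have ha' : a ∈ closedBall a (r / 6) := mem_closedBall_self (by positivity)
    have h := (convex_closedBall a (r / 6)).norm_image_sub_le_of_norm_hasDerivWithin_le
      (f := fun w => g w - deriv g a * w) (f' := fun w => deriv g w - deriv g a) (C := A / 2)
      (fun w hw => by
        simpa using ((hgat w hw).hasDerivAt.fun_sub
          ((hasDerivAt_id w).const_mul (deriv g a))).hasDerivWithinAt)
      hD ha' hz'
    have hza : ‖z - a‖ = r / 6 := by rw [← dist_eq_norm]; exact hz
    have e : deriv g a * (z - a) = (g z - g a) -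
        ((g z - deriv g a * z) - (g a - deriv g a * a)) := by ring
    have h2 : ‖deriv g a * (z - a)‖ ≤ ‖g z - g a‖ + A / 2 * ‖z - a‖ := by
      rw [e]
      exact (norm_sub_le _ _).trans (by gcongr)
    rw [norm_mul, ← hA, hza] at h2
    linarith
  have hdc : DiffContOnCl ℂ g (ball a (r / 6)) :=
    DifferentiableOn.diffContOnCl (hg.mono (closure_ball_subset_closedBall.trans hsub))
  have hne : ∃ᶠ z in 𝓝 a, g z ≠ g a := by
    have h := (hgat a (mem_closedBall_self (by positivity))).hasDerivAt.eventually_ne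
      (c := g a) h0
    exact h.frequently.filter_mono nhdsWithin_le_nhds
  have h := hdc.ball_subset_image_closedBall (by positivity) hlow hne
  rw [show r * A / 24 = r * A / 12 / 2 by ring]
  exact h.trans (image_mono hsub)

theorem norm_deriv_mul_le_of_forall_exists_notMem_image {g : ℂ → ℂ} {c : ℂ} {R d : ℝ}
    (hg : DifferentiableOn ℂ g (ball c R)) (hd : 0 < d)
    (hom : ∀ w : ℂ, ∃ u, ‖u - w‖ < d ∧ u ∉ g '' ball c R) {z : ℂ} (hz : z ∈ ball c (R / 2)) :
    ‖deriv g z‖ * R ≤ 192 * d := by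
  have hR : 0 < R := by
    have := pos_of_mem_ball hz
    linarith
  set ρ := 3 * R / 4 with hρ
  have hsub : closedBall c ρ ⊆ ball c R := closedBall_subset_ball (by linarith)
  have hzρ : z ∈ closedBall c ρ := by
    rw [mem_ball] at hz
    rw [mem_closedBall]
    linarith
  obtain ⟨a, ha, hmax⟩ := (isCompact_closedBall c ρ).exists_isMaxOn ⟨z, hzρ⟩
    (f := fun z => ‖deriv g z‖ * (ρ - dist z c))
    (((hg.deriv isOpen_ball).continuousOn.mono hsub).norm.mul (by fun_prop))
  have hmax' : ∀ w ∈ closedBall c ρ, ‖deriv g w‖ * (ρ - dist w c) ≤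
      ‖deriv g a‖ * (ρ - dist a c) := fun w hw => hmax hw
  suffices h : ‖deriv g a‖ * (ρ - dist a c) ≤ 48 * d by
    have h1 := (hmax' z hzρ).trans h
    rw [mem_ball] at hz
    nlinarith [norm_nonneg (deriv g z)]
  by_contra! hlt
  have hpos : 0 < ‖deriv g a‖ * (ρ - dist a c) := lt_trans (by positivity) hlt
  have hane : 0 < ‖deriv g a‖ := (norm_nonneg _).lt_of_ne' fun h => by simp [h] at hpos
  set r := (ρ - dist a c) / 2 with hr
  have hrpos : 0 < r := by
    have := (mul_pos_iff_of_pos_left hane).1 hpos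
    linarith
  have hballρ : ball a r ⊆ closedBall c ρ := fun w hw => by
    rw [mem_ball] at hw
    rw [mem_closedBall]
    linarith [dist_triangle w a c]
  have hB := ball_subset_image_of_norm_deriv_le hrpos (hg.mono (hballρ.trans hsub))
    (norm_pos_iff.1 hane) (fun w hw => by
      have h1 := hmax' w (hballρ hw)
      rw [mem_ball] at hw
      have h2 : r ≤ ρ - dist w c := by linarith [dist_triangle w a c]
      have h3 : ‖deriv g w‖ * r ≤ ‖deriv g w‖ * (ρ - dist w c) := by gcongr
      have h4 : ‖deriv g w‖ * r ≤ (2 * ‖deriv g a‖) * r := by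
        refine (h3.trans h1).trans_eq ?_
        rw [hr]
        ring
      exact le_of_mul_le_mul_right h4 hrpos)
  obtain ⟨u, hu, hun⟩ := hom (g a)
  refine hun (image_mono (hballρ.trans hsub) (hB ?_))
  rw [mem_ball, dist_eq_norm]
  refine hu.trans ?_
  rw [hr]
  linarith

/-- **Schottky's theorem** for holomorphic functions omitting the values `1` and `-1`. -/
theorem exists_norm_le_of_ne_one_of_ne_neg_one (M : ℝ) :
    ∃ C : ℝ, ∀ (F : ℂ → ℂ) (c : ℂ) (R : ℝ), DifferentiableOn ℂ F (ball c R) →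
      (∀ z ∈ ball c R, F z ≠ 1) → (∀ z ∈ ball c R, F z ≠ -1) → ‖F c‖ ≤ M →
      ∀ z ∈ ball c (R / 2), ‖F z‖ ≤ C := by
  refine ⟨Real.exp (Real.pi * Real.exp (Real.pi * (4 * M + 195))), ?_⟩
  intro F c R hF h1 h2 hM z hz
  have hR : 0 < R := by
    have := pos_of_mem_ball hz
    linarith
  obtain ⟨G, hGd, hG, hGc⟩ := exists_cos_pi_mul_eq_on_ball hR hF h1 h2
  have hGint : ∀ w ∈ ball c R, ∀ m : ℤ, G w ≠ m := by
    intro w hw m h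
    have h3 : F w = ((-1) ^ m : ℝ) := by
      rw [← hG w hw, h, ← Real.cos_int_mul_pi]
      push_cast
      rw [mul_comm]
    rcases Int.even_or_odd m with hm | hm
    · exact h1 w hw (by simpa [hm.neg_one_zpow] using h3)
    · exact h2 w hw (by simpa [hm.neg_one_zpow] using h3)
  obtain ⟨g, hgd, hg, hgc⟩ := exists_cos_pi_mul_eq_on_ball hR hGd
    (fun w hw => by simpa using hGint w hw 1) (fun w hw => by simpa using hGint w hw (-1))
  have hom : ∀ w : ℂ, ∃ u, ‖u - w‖ < 2 ∧ u ∉ g '' ball c R := by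
    intro w
    obtain ⟨u, hu, m, hm⟩ := exists_cos_pi_mul_eq_intCast_near w
    refine ⟨u, hu, ?_⟩
    rintro ⟨x, hx, rfl⟩
    exact hGint x hx m (by rw [← hg x hx, hm])
  have hsub : ball c (R / 2) ⊆ ball c R := ball_subset_ball (by linarith)
  have hdiff : ‖g z - g c‖ ≤ 192 := by
    have h := (convex_ball c (R / 2)).norm_image_sub_le_of_norm_deriv_le (f := g) (C := 384 / R)
      (fun w hw => hgd.differentiableAt (isOpen_ball.mem_nhds (hsub hw)))
      (fun w hw => by
        rw [le_div_iff₀ hR]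
        exact (norm_deriv_mul_le_of_forall_exists_notMem_image hgd two_pos hom hw).trans_eq
          (by norm_num))
      (mem_ball_self (by linarith)) hz
    refine h.trans ?_
    calc 384 / R * ‖z - c‖ ≤ 384 / R * (R / 2) := by
          gcongr
          rw [← dist_eq_norm]
          exact (mem_ball.1 hz).le
      _ = 192 := by field_simp; norm_num
  have hgz : ‖g z‖ ≤ 4 * M + 195 := by
    have := norm_sub_norm_le (g z) (g c)
    linarith
  have hnorm : ∀ w : ℂ, ‖Complex.cos (Real.pi * w)‖ ≤ Real.exp (Real.pi * ‖w‖) := fun w => by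
    simpa [abs_of_pos Real.pi_pos] using Complex.norm_cos_le_exp_norm (Real.pi * w)
  have hGz : ‖G z‖ ≤ Real.exp (Real.pi * (4 * M + 195)) := by
    rw [← hg z (hsub hz)]
    exact (hnorm _).trans (by gcongr)
  rw [← hG z (hsub hz)]
  exact (hnorm _).trans (by gcongr)

/-- **Schottky's theorem** for holomorphic functions omitting two distinct values. -/
theorem exists_norm_le_of_ne_of_ne {a b : ℂ} (hab : a ≠ b) (M : ℝ) :
    ∃ C : ℝ, ∀ (f : ℂ → ℂ) (c : ℂ) (R : ℝ), DifferentiableOn ℂ f (ball c R) →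
      (∀ z ∈ ball c R, f z ≠ a) → (∀ z ∈ ball c R, f z ≠ b) → ‖f c‖ ≤ M →
      ∀ z ∈ ball c (R / 2), ‖f z‖ ≤ C := by
  have hba : b - a ≠ 0 := sub_ne_zero.2 hab.symm
  obtain ⟨C, hC⟩ := exists_norm_le_of_ne_one_of_ne_neg_one ((2 * M + ‖a + b‖) / ‖b - a‖)
  refine ⟨(‖b - a‖ * C + ‖a + b‖) / 2, fun f c R hf h1 h2 hM z hz => ?_⟩
  have h := hC (fun z => (2 * f z - (a + b)) / (b - a)) c R
    (((hf.const_mul 2).sub_const _).div_const _)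
    (fun z hz h => h2 z hz (by
      rw [div_eq_iff hba] at h
      linear_combination h / 2))
    (fun z hz h => h1 z hz (by
      rw [div_eq_iff hba] at h
      linear_combination h / 2))
    (by
      rw [norm_div]
      gcongr
      refine (norm_sub_le _ _).trans ?_
      rw [norm_mul, Complex.norm_ofNat]
      gcongr) z hz
  have e : f z = ((b - a) * ((2 * f z - (a + b)) / (b - a)) + (a + b)) / 2 := by
    field_simp
    ring
  rw [e, norm_div, Complex.norm_ofNat]
  gcongr
  refine (norm_add_le _ _).trans ?_
  rw [norm_mul]
  gcongr

/-- **Montel's theorem** for uniformly bounded sequences of holomorphic functions on a disc. -/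
theorem exists_subseq_tendstoLocallyUniformlyOn_of_norm_le {f : ℕ → ℂ → ℂ} {c : ℂ} {R C : ℝ}
    (hR : 0 < R) (hf : ∀ n, DifferentiableOn ℂ (f n) (ball c R))
    (hC : ∀ n, ∀ z ∈ ball c R, ‖f n z‖ ≤ C) :
    ∃ φ : ℕ → ℕ, StrictMono φ ∧ ∃ g : ℂ → ℂ, DifferentiableOn ℂ g (ball c (R / 2)) ∧
      TendstoLocallyUniformlyOn (fun n => f (φ n)) g atTop (ball c (R / 2)) := by
  classical
  set K := closedBall c (R / 2) with hK
  have hKc : IsCompact K := isCompact_closedBall c (R / 2)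
  have : CompactSpace K := isCompact_iff_compactSpace.1 hKc
  have hKR : K ⊆ ball c R := closedBall_subset_ball (by linarith)
  have hC0 : 0 ≤ C := (norm_nonneg _).trans (hC 0 c (mem_ball_self hR))
  have hderiv : ∀ n, ∀ z ∈ K, ‖deriv (f n) z‖ ≤ C / (R / 4) := by
    intro n z hz
    have hsub : closedBall z (R / 4) ⊆ ball c R := fun w hw => by
      rw [hK, mem_closedBall] at hz
      rw [mem_closedBall] at hw
      rw [mem_ball]
      linarith [dist_triangle w z c]
    exact Complex.norm_deriv_le_of_forall_mem_sphere_norm_le (by positivity)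
      (((hf n).mono (closure_ball_subset_closedBall.trans hsub)).diffContOnCl)
      fun w hw => hC n w (hsub (sphere_subset_closedBall hw))
  have hlip : ∀ n, ∀ z ∈ K, ∀ w ∈ K, ‖f n w - f n z‖ ≤ C / (R / 4) * ‖w - z‖ := fun n z hz w hw =>
    (convex_closedBall c (R / 2)).norm_image_sub_le_of_norm_deriv_le
      (fun x hx => (hf n).differentiableAt (isOpen_ball.mem_nhds (hKR hx))) (hderiv n) hz hw
  let F : ℕ → BoundedContinuousFunction K ℂ := fun n =>
    BoundedContinuousFunction.mkOfCompact ⟨K.domRestrict (f n),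
      ((hf n).continuousOn.mono hKR).domRestrict⟩
  have hFapp : ∀ n (x : K), F n x = f n x := fun _ _ => rfl
  have hcomp : IsCompact (closure (range F)) := by
    refine BoundedContinuousFunction.arzela_ascoli (closedBall 0 C) (isCompact_closedBall 0 C)
      (range F) ?_ ?_
    · rintro _ x ⟨n, rfl⟩
      rw [mem_closedBall_zero_iff, hFapp]
      exact hC n x (hKR x.2)
    · refine (LipschitzWith.uniformEquicontinuous _ (Real.toNNReal (C / (R / 4))) ?_).equicontinuous
      rintro ⟨_, n, rfl⟩
      refine LipschitzWith.of_dist_le_mul fun x y => ?_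
      rw [Real.coe_toNNReal _ (by positivity), dist_eq_norm, Subtype.dist_eq, dist_eq_norm]
      exact hlip n y y.2 x x.2
  obtain ⟨G, -, φ, hφ, hlim⟩ := hcomp.tendsto_subseq fun n => subset_closure (mem_range_self n)
  refine ⟨φ, hφ, fun z => if h : z ∈ K then G ⟨z, h⟩ else 0, ?_⟩
  have hunif : TendstoUniformlyOn (fun n => f (φ n))
      (fun z => if h : z ∈ K then G ⟨z, h⟩ else 0) atTop K := by
    rw [tendstoUniformlyOn_iff_tendstoUniformly_comp_coe]
    have e : (fun z => if h : z ∈ K then G ⟨z, h⟩ else 0) ∘ Subtype.val = G := by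
      ext x
      simp [x.2]
    rw [e]
    exact BoundedContinuousFunction.tendsto_iff_tendstoUniformly.1 hlim
  have hloc := hunif.tendstoLocallyUniformlyOn.mono (ball_subset_closedBall (x := c) (ε := R / 2))
  exact ⟨hloc.differentiableOn (Eventually.of_forall fun n =>
    (hf (φ n)).mono (ball_subset_closedBall.trans hKR)) isOpen_ball, hloc⟩

/-- **Montel's fundamental normality test**: a sequence of holomorphic functions on a disc omitting
two distinct values has a subsequence converging locally uniformly, possibly to `∞`, on a
concentric disc. -/
theorem exists_subseq_tendsto_of_ne_of_ne {a b : ℂ} (hab : a ≠ b) {f : ℕ → ℂ → ℂ} {c : ℂ} {R : ℝ}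
    (hR : 0 < R) (hf : ∀ n, DifferentiableOn ℂ (f n) (ball c R))
    (ha : ∀ n, ∀ z ∈ ball c R, f n z ≠ a) (hb : ∀ n, ∀ z ∈ ball c R, f n z ≠ b) :
    ∃ φ : ℕ → ℕ, StrictMono φ ∧
      ((∃ g : ℂ → ℂ, DifferentiableOn ℂ g (ball c (R / 4)) ∧
          TendstoLocallyUniformlyOn (fun n => f (φ n)) g atTop (ball c (R / 4))) ∨
        TendstoInftyLocallyUniformlyOn (fun n => f (φ n)) (ball c (R / 4))) := by
  by_cases hbdd : ∃ M : ℝ, ∃ᶠ n in atTop, ‖f n c‖ ≤ M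
  · obtain ⟨M, hM⟩ := hbdd
    obtain ⟨φ, hφ, hφM⟩ := extraction_of_frequently_atTop hM
    obtain ⟨C, hC⟩ := exists_norm_le_of_ne_of_ne hab M
    obtain ⟨ψ, hψ, g, hg, hlim⟩ := exists_subseq_tendstoLocallyUniformlyOn_of_norm_le
      (f := fun n => f (φ n)) (half_pos hR)
      (fun n => (hf (φ n)).mono (ball_subset_ball (by linarith)))
      (fun n => hC _ c R (hf _) (ha _) (hb _) (hφM n))
    rw [show R / 2 / 2 = R / 4 by ring] at hg hlim
    exact ⟨φ ∘ ψ, hφ.comp hψ, Or.inl ⟨g, hg, hlim⟩⟩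
  · refine ⟨id, strictMono_id, Or.inr fun M K hK _ => ?_⟩
    obtain ⟨C, hC⟩ := exists_norm_le_of_ne_of_ne hab M
    simp only [not_exists, not_frequently, not_le] at hbdd
    filter_upwards [hbdd C] with n hn z hz
    by_contra! hlt
    have hzc : dist z c < R / 4 := hK hz
    have hsub : ball z (2 * R / 3) ⊆ ball c R := ball_subset_ball' (by linarith)
    refine hn.not_ge (hC (f n) z (2 * R / 3) ((hf n).mono hsub) (fun w hw => ha n w (hsub hw))
      (fun w hw => hb n w (hsub hw)) hlt.le c ?_)
    rw [mem_ball, dist_comm]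
    linarith

end

/-- If `ℂ \ D` contains at least two points and the Julia like
set of `𝓕` is forward invariant under `𝓕`, then it has empty interior. -/
theorem interior_juliaLike_empty (D : Set ℂ) (hD : IsOpen D)
    (hDconn : IsConnected D)
    (hcompl : ∃ a b : ℂ, a ≠ b ∧ a ∉ D ∧ b ∉ D)
    (𝓕 : Set (ℂ → ℂ)) (hol : ∀ f ∈ 𝓕, DifferentiableOn ℂ f D)
    (hFwd : ∀ f ∈ 𝓕, f '' juliaLike 𝓕 D ⊆ juliaLike 𝓕 D) :
    interior (juliaLike 𝓕 D) = ∅ := by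
  obtain ⟨a, b, hab, haD, hbD⟩ := hcompl
  refine Set.eq_empty_iff_forall_notMem.2 fun z hz => ?_
  obtain ⟨R, hR, hball⟩ := Metric.isOpen_iff.1 isOpen_interior z hz
  replace hball := hball.trans interior_subset
  have hJD : juliaLike 𝓕 D ⊆ D := Set.sdiff_subset
  have hmaps : ∀ f ∈ 𝓕, ∀ w ∈ Metric.ball z R, f w ∈ D := fun f hf w hw =>
    hJD (hFwd f hf (Set.mem_image_of_mem f (hball hw)))
  have hzJ := interior_subset hz
  refine hzJ.2 ⟨hzJ.1, Metric.ball z (R / 4), Metric.isOpen_ball,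
    Metric.mem_ball_self (by positivity),
    (Metric.ball_subset_ball (by linarith)).trans (hball.trans hJD), fun f hf => ?_⟩
  exact exists_subseq_tendsto_of_ne_of_ne hab hR
    (fun n => (hol _ (hf n)).mono (hball.trans hJD))
    (fun n w hw h => haD (h ▸ hmaps _ (hf n) w hw))
    (fun n w hw h => hbD (h ▸ hmaps _ (hf n) w hw))
end

section
/- Let 𝓕 be a family of transcendental entire functions (a family of holomorphic functions on D = ℂ, each not a polynomial) such that J(𝓕) contains at least three points. Then for any w₀ ∈ J(𝓕) and any f ∈ 𝓕 with truncated Nevanlinna deficiency Θ(w₀, f) < 1/2, there exist a sequence {wₙ} with wₙ → w₀ and a sequence {fₙ} ⊆ 𝓕 such that each wₙ is a repelling fixed point of the composition f ∘ fₙ. -/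
open Filter Topology

/-- The Nevanlinna proximity function `m(r, f)` of an entire function. -/
noncomputable def proximityFn (r : ℝ) (f : ℂ → ℂ) : ℝ :=
  (2 * Real.pi)⁻¹ *
    ∫ θ in (0:ℝ)..(2 * Real.pi),
      max 0 (Real.log ‖f ((r : ℂ) * Complex.exp ((θ : ℂ) * Complex.I))‖)

/-- The truncated counting function `N̄(r, a, f)`, counting the distinct
`a`-points of `f` (ignoring multiplicities). -/
noncomputable def countingBarFn (r : ℝ) (a : ℂ) (f : ℂ → ℂ) : ℝ :=
  ∫ t in (0:ℝ)..r, ((Set.ncard {z : ℂ | ‖z‖ ≤ t ∧ f z = a} : ℝ) / t)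

/-- The Nevanlinna characteristic `T(r, f)` of an entire function `f`:
since `f` has no poles, `T(r, f) = m(r, f)`. -/
noncomputable def nevanlinnaT (r : ℝ) (f : ℂ → ℂ) : ℝ := proximityFn r f

/-- The truncated Nevanlinna deficiency
`Θ(a, f) = 1 - limsup_{r → ∞} N̄(r, a, f) / T(r, f)`. -/
noncomputable def truncatedDefect (a : ℂ) (f : ℂ → ℂ) : ℝ :=
  1 - Filter.limsup (fun r : ℝ => countingBarFn r a f / nevanlinnaT r f) Filter.atTop

/-- An entire function is transcendental if it is not a polynomial. -/
def TranscendentalEntire (f : ℂ → ℂ) : Prop :=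
  Differentiable ℂ f ∧ ¬ ∃ p : Polynomial ℂ, ∀ z, f z = p.eval z

open Metric in
theorem poissonKernel_bounds {c w z : ℂ} {R : ℝ} (hz : z ∈ sphere c R) (hw : w ∈ ball c R) :
    (R - ‖w - c‖) / (R + ‖w - c‖) ≤ poissonKernel c w z ∧
      poissonKernel c w z ≤ (R + ‖w - c‖) / (R - ‖w - c‖) := by
  rw [poissonKernel_eq_re_herglotzRieszKernel]
  exact ⟨le_re_herglotzRieszKernel hz hw, re_herglotzRieszKernel_le hz hw⟩

open Metric in
theorem continuousOn_poissonKernel {c w : ℂ} {R : ℝ} (hw : w ∈ ball c R) :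
    ContinuousOn (poissonKernel c w) (sphere c |R|) := by
  rw [poissonKernel_eq_re_herglotzRieszKernel]
  exact Complex.continuous_re.comp_continuousOn (continuousOn_herglotzRieszKernel_sphere hw)

open Metric in
/-- Upper Poisson estimate for a harmonic function by the circle average of any majorant. -/
theorem harmonic_le_mul_circleAverage {u v : ℂ → ℝ} {c w : ℂ} {R : ℝ}
    (hu : InnerProductSpace.HarmonicOnNhd u (closedBall c R)) (hw : w ∈ ball c R)
    (hv : CircleIntegrable v c R) (huv : ∀ z ∈ sphere c R, u z ≤ v z)
    (hv0 : ∀ z ∈ sphere c R, 0 ≤ v z) :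
    u w ≤ (R + ‖w - c‖) / (R - ‖w - c‖) * Real.circleAverage v c R := by
  have hR : 0 < R := pos_of_mem_ball hw
  rw [← hu.circleAverage_poissonKernel_smul hw, ← smul_eq_mul, ← Real.circleAverage_smul]
  have hus : ContinuousOn u (sphere c |R|) := by
    rw [abs_of_pos hR]
    exact fun z hz => (hu z (sphere_subset_closedBall hz)).1.continuousAt.continuousWithinAt
  apply Real.circleAverage_mono
  · exact ((continuousOn_poissonKernel hw).smul hus).circleIntegrable'
  · exact hv.const_smul
  · intro z hz
    rw [abs_of_pos hR] at hz
    have hk := poissonKernel_bounds hz hw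
    have h0 : 0 ≤ poissonKernel c w z := by
      refine le_trans ?_ hk.1
      have : ‖w - c‖ < R := mem_ball_iff_norm.1 hw
      apply div_nonneg <;> linarith [norm_nonneg (w - c)]
    simp only [Pi.smul_apply', Pi.smul_apply, smul_eq_mul]
    calc _ ≤ poissonKernel c w z * v z := by gcongr; exact huv z hz
      _ ≤ _ := by gcongr; exacts [hv0 z hz, hk.2]

open Metric in
/-- Harnack's inequality, lower estimate. -/
theorem harmonic_mul_center_le {u : ℂ → ℝ} {c w : ℂ} {R : ℝ}
    (hu : InnerProductSpace.HarmonicOnNhd u (closedBall c R)) (hw : w ∈ ball c R)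
    (hu0 : ∀ z ∈ sphere c R, 0 ≤ u z) :
    (R - ‖w - c‖) / (R + ‖w - c‖) * u c ≤ u w := by
  have hR : 0 < R := pos_of_mem_ball hw
  have huc : Real.circleAverage u c R = u c :=
    InnerProductSpace.HarmonicOnNhd.circleAverage_eq (by rwa [abs_of_pos hR])
  rw [← huc, ← hu.circleAverage_poissonKernel_smul hw, ← smul_eq_mul, ← Real.circleAverage_smul]
  have hus : ContinuousOn u (sphere c |R|) := by
    rw [abs_of_pos hR]
    exact fun z hz => (hu z (sphere_subset_closedBall hz)).1.continuousAt.continuousWithinAt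
  apply Real.circleAverage_mono
  · exact hus.circleIntegrable'.const_smul
  · exact ((continuousOn_poissonKernel hw).smul hus).circleIntegrable'
  · intro z hz
    rw [abs_of_pos hR] at hz
    have hk := poissonKernel_bounds hz hw
    simp only [Pi.smul_apply', Pi.smul_apply, smul_eq_mul]
    gcongr
    exacts [hu0 z hz, hk.1]

open Metric in
/-- Harnack's inequality, upper estimate. -/
theorem harmonic_le_mul_center {u : ℂ → ℝ} {c w : ℂ} {R : ℝ}
    (hu : InnerProductSpace.HarmonicOnNhd u (closedBall c R)) (hw : w ∈ ball c R)
    (hu0 : ∀ z ∈ sphere c R, 0 ≤ u z) :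
    u w ≤ (R + ‖w - c‖) / (R - ‖w - c‖) * u c := by
  have hR : 0 < R := pos_of_mem_ball hw
  have huc : Real.circleAverage u c R = u c :=
    InnerProductSpace.HarmonicOnNhd.circleAverage_eq (by rwa [abs_of_pos hR])
  have hus : ContinuousOn u (sphere c |R|) := by
    rw [abs_of_pos hR]
    exact fun z hz => (hu z (sphere_subset_closedBall hz)).1.continuousAt.continuousWithinAt
  rw [← huc]
  exact harmonic_le_mul_circleAverage hu hw hus.circleIntegrable' (fun _ _ => le_rfl) hu0

open Metric in
theorem harnack_of_norm_ge {f : ℂ → ℂ} (hf : Differentiable ℂ f) {z ζ : ℂ} {r : ℝ} (hr : 0 < r)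
    (hlow : ∀ x ∈ ball z r, 1 / 3 ≤ ‖f x‖) (hζ : ‖ζ - z‖ ≤ r / 10) :
    (3 * ‖f ζ‖) ^ 2 ≤ (3 * ‖f z‖) ^ 3 ∧ (3 * ‖f z‖) ^ 2 ≤ (3 * ‖f ζ‖) ^ 3 := by
  set u : ℂ → ℝ := fun x => Real.log ‖3 * f x‖ with hu
  have hsub : closedBall z (r / 2) ⊆ ball z r := closedBall_subset_ball (by linarith)
  have hpos : ∀ x ∈ ball z r, 1 ≤ ‖3 * f x‖ := by
    intro x hx
    have := hlow x hx
    simp only [norm_mul, Complex.norm_ofNat]; linarith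
  have hharm : InnerProductSpace.HarmonicOnNhd u (closedBall z (r / 2)) := by
    intro x hx
    apply AnalyticAt.harmonicAt_log_norm
    · exact (analyticAt_const.mul (hf.analyticAt x))
    · rw [← norm_pos_iff]; linarith [hpos x (hsub hx)]
  have hu0 : ∀ x ∈ ball z r, 0 ≤ u x := fun x hx => Real.log_nonneg (hpos x hx)
  have hw : ζ ∈ ball z (r / 2) := by rw [mem_ball_iff_norm]; linarith
  have h1 := harmonic_le_mul_center hharm hw (fun x hx => hu0 x (hsub (sphere_subset_closedBall hx)))
  have h2 := harmonic_mul_center_le hharm hw (fun x hx => hu0 x (hsub (sphere_subset_closedBall hx)))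
  have huz : 0 ≤ u z := hu0 z (mem_ball_self hr)
  have hzb : z ∈ ball z r := mem_ball_self hr
  have hζb : ζ ∈ ball z r := by rw [mem_ball_iff_norm]; linarith
  have k1 : (r / 2 + ‖ζ - z‖) / (r / 2 - ‖ζ - z‖) ≤ 3 / 2 := by
    rw [div_le_iff₀ (by linarith)]; linarith
  have k2 : 2 / 3 ≤ (r / 2 - ‖ζ - z‖) / (r / 2 + ‖ζ - z‖) := by
    rw [le_div_iff₀ (by positivity)]; linarith
  have h1' : 2 * u ζ ≤ 3 * u z := by nlinarith [mul_le_mul_of_nonneg_right k1 huz]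
  have h2' : 2 * u z ≤ 3 * u ζ := by nlinarith [mul_le_mul_of_nonneg_right k2 huz]
  have e : ∀ x, ‖3 * f x‖ = 3 * ‖f x‖ := fun x => by simp
  simp only [hu, e] at h1' h2'
  have pz := hpos z hzb
  have pζ := hpos ζ hζb
  rw [e] at pz pζ
  constructor
  · rw [← Real.log_le_log_iff (by positivity) (by positivity), Real.log_pow, Real.log_pow]
    exact_mod_cast h1'
  · rw [← Real.log_le_log_iff (by positivity) (by positivity), Real.log_pow, Real.log_pow]
    exact_mod_cast h2'

open Metric in
theorem norm_le_two_mul_of_spherical {f : ℂ → ℂ} (hf : Differentiable ℂ f) {z x y : ℂ}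
    {r C m : ℝ} (hC : 0 ≤ C) (hm : 0 < m)
    (hb : ∀ ζ ∈ ball z r, ‖deriv f ζ‖ ≤ C * (1 + ‖f ζ‖ ^ 2)) (hx : x ∈ ball z r)
    (hy : y ∈ ball z r) (hfx : ‖f x‖ ≤ m) (hs : C * (1 + (2 * m) ^ 2) * ‖y - x‖ < m) :
    ‖f y‖ ≤ 2 * m := by
  set γ : ℝ → ℂ := fun t => x + t * (y - x) with hγ
  have hγd : ∀ t, HasDerivAt γ (y - x) t := by
    intro t
    have : HasDerivAt γ (1 * (y - x)) t :=
      ((Complex.ofRealCLM.hasDerivAt (x := t)).mul_const (y - x)).const_add x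
    rwa [one_mul] at this
  have hd : ∀ t, HasDerivAt (fun t => f (γ t)) (deriv f (γ t) * (y - x)) t := fun t =>
    (hf (γ t)).hasDerivAt.comp_of_eq t (hγd t) rfl
  have hmem : ∀ t ∈ Set.Icc (0 : ℝ) 1, γ t ∈ ball z r := by
    intro t ht
    have := (convex_ball z r).add_smul_sub_mem hx hy ht
    simpa [hγ] using this
  have key := image_norm_le_of_norm_deriv_right_lt_deriv_boundary (a := 0) (b := 1)
    (f := fun t => f (γ t)) (f' := fun t => deriv f (γ t) * (y - x))
    (B := fun t => m + m * t) (B' := fun _ => m)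
    (fun t _ => (hd t).continuousAt.continuousWithinAt) (fun t _ => (hd t).hasDerivWithinAt)
    (by simpa [hγ] using hfx)
    (fun t => by simpa using ((hasDerivAt_id t).const_mul m).const_add m) ?_
    (x := 1) (by simp)
  · have e : γ 1 = y := by simp [hγ]
    simp only [e] at key
    linarith
  · intro t ht heq
    have h1 := hb (γ t) (hmem t ⟨ht.1, ht.2.le⟩)
    rw [norm_mul]
    have h2 : ‖f (γ t)‖ ≤ 2 * m := by rw [heq]; nlinarith [ht.2]
    refine lt_of_le_of_lt ?_ hs
    gcongr
    exact h1.trans (by gcongr)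

section Growth
open Metric

variable {f : ℂ → ℂ} {z ζ : ℂ} {r C c : ℝ}

theorem third_le_norm_of_spherical (hf : Differentiable ℂ f) (hC : 0 < C) (hr : 0 < r)
    (hCr : 6 * C * r ≤ 1) (hb : ∀ ζ ∈ ball z r, ‖deriv f ζ‖ ≤ C * (1 + ‖f ζ‖ ^ 2))
    (hz : 1 ≤ ‖f z‖) : ∀ x ∈ ball z r, 1 / 3 ≤ ‖f x‖ := by
  intro x hx
  by_contra! h
  have hxz : ‖z - x‖ < r := by rw [norm_sub_rev]; exact mem_ball_iff_norm.1 hx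
  have := norm_le_two_mul_of_spherical hf hC.le (by norm_num : (0 : ℝ) < 1 / 3) hb hx
    (mem_ball_self hr) h.le (by
      have : C * ‖z - x‖ ≤ C * r := by gcongr
      nlinarith)
  linarith

theorem norm_le_of_spherical (hf : Differentiable ℂ f) (hC : 0 < C) (hr : 0 < r)
    (hCr : 6 * C * r ≤ 1) (hb : ∀ ζ ∈ ball z r, ‖deriv f ζ‖ ≤ C * (1 + ‖f ζ‖ ^ 2))
    (hζ : ‖ζ - z‖ ≤ r / 10) : ‖f ζ‖ ≤ 2 + 3 * ‖f z‖ ^ 3 := by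
  rcases le_total ‖f z‖ 1 with h | h
  · have hζb : ζ ∈ ball z r := by rw [mem_ball_iff_norm]; linarith
    have := norm_le_two_mul_of_spherical hf hC.le one_pos hb (mem_ball_self hr) hζb h (by
      have : C * ‖ζ - z‖ ≤ C * (r / 10) := by gcongr
      nlinarith)
    have : 0 ≤ ‖f z‖ ^ 3 := by positivity
    linarith
  · have h1 := (harnack_of_norm_ge hf hr (third_le_norm_of_spherical hf hC hr hCr hb h) hζ).1
    have h3 : 1 ≤ ‖f z‖ ^ 3 := one_le_pow₀ h
    by_contra! h4
    have : (2 + 3 * ‖f z‖ ^ 3) ^ 2 ≤ ‖f ζ‖ ^ 2 := by gcongr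
    nlinarith

theorem sq_le_of_spherical (hf : Differentiable ℂ f) (hC : 0 < C) (hr : 0 < r)
    (hCr : 6 * C * r ≤ 1) (hb : ∀ ζ ∈ ball z r, ‖deriv f ζ‖ ≤ C * (1 + ‖f ζ‖ ^ 2))
    (hz : 1 ≤ ‖f z‖) (hζ : ‖ζ - z‖ ≤ r / 10) : ‖f z‖ ^ 2 ≤ 3 * ‖f ζ‖ ^ 3 := by
  have h1 := (harnack_of_norm_ge hf hr (third_le_norm_of_spherical hf hC hr hCr hb hz) hζ).2
  nlinarith

theorem norm_le_of_sq_le_norm_deriv (hf : Differentiable ℂ f) (hC : 0 < C) (hr : 0 < r)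
    (hCr : 6 * C * r ≤ 1) (hb : ∀ ζ ∈ ball z r, ‖deriv f ζ‖ ≤ C * (1 + ‖f ζ‖ ^ 2))
    (hz : 1 ≤ ‖f z‖) (hc : 0 < c) (hd : c * ‖f z‖ ^ 2 ≤ ‖deriv f z‖) :
    ‖f z‖ ≤ 300 / (r * c) ^ 2 := by
  set x := ‖f z‖ with hx
  have h1 : ∀ ζ ∈ sphere z (r / 10), ‖f ζ‖ ≤ √(3 * x ^ 3) := by
    intro ζ hζ
    have := (harnack_of_norm_ge hf hr (third_le_norm_of_spherical hf hC hr hCr hb hz)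
      (mem_sphere_iff_norm.1 hζ).le).1
    apply Real.le_sqrt_of_sq_le
    rw [← hx] at this
    nlinarith
  have h2 := Complex.norm_deriv_le_of_forall_mem_sphere_norm_le (by positivity)
    hf.diffContOnCl h1
  have h3 : c * x ^ 2 * (r / 10) ≤ √(3 * x ^ 3) := by
    rw [le_div_iff₀ (by positivity)] at h2
    refine le_trans ?_ h2
    gcongr
  have h4 : (c * x ^ 2 * (r / 10)) ^ 2 ≤ 3 * x ^ 3 := by
    rw [← Real.sq_sqrt (by positivity : 0 ≤ 3 * x ^ 3)]
    gcongr
  rw [le_div_iff₀ (by positivity)]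
  have h5 : x ^ 3 * (x * (r * c) ^ 2) ≤ x ^ 3 * 300 := by nlinarith
  exact le_of_mul_le_mul_left h5 (by positivity)

/-- A spherical derivative bound on a large disc and a bound at the origin give a bound on
smaller discs. -/
theorem exists_bound_of_spherical (hC : 0 < C) (hr : 0 < r) (hCr : 6 * C * r ≤ 1) (M R : ℝ) :
    ∃ B : ℝ, ∀ f : ℂ → ℂ, Differentiable ℂ f →
      (∀ ζ ∈ ball (0 : ℂ) (R + r), ‖deriv f ζ‖ ≤ C * (1 + ‖f ζ‖ ^ 2)) → ‖f 0‖ ≤ M →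
      ∀ ζ ∈ closedBall (0 : ℂ) R, ‖f ζ‖ ≤ B := by
  have main : ∀ k : ℕ, ∃ B : ℝ, ∀ f : ℂ → ℂ, Differentiable ℂ f →
      (∀ ζ ∈ ball (0 : ℂ) (R + r), ‖deriv f ζ‖ ≤ C * (1 + ‖f ζ‖ ^ 2)) → ‖f 0‖ ≤ M →
      ∀ ζ ∈ closedBall (0 : ℂ) R, ‖ζ‖ ≤ k * (r / 10) → ‖f ζ‖ ≤ B := by
    intro k
    induction k with
    | zero =>
      refine ⟨M, fun f _ _ h0 ζ _ hζ => ?_⟩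
      have : ζ = 0 := by simpa using hζ
      rwa [this]
    | succ k ih =>
      obtain ⟨B, hB⟩ := ih
      refine ⟨2 + 3 * B ^ 3, fun f hf hb h0 ζ hζR hζ => ?_⟩
      set t : ℝ := k / (k + 1) with ht
      have ht0 : 0 ≤ t := by positivity
      have ht1 : t ≤ 1 := by rw [ht, div_le_one (by positivity)]; linarith
      have hζR' : ‖ζ‖ ≤ R := by simpa using hζR
      have hnz : ‖(t : ℂ) * ζ‖ = t * ‖ζ‖ := by
        rw [norm_mul, Complex.norm_real, Real.norm_of_nonneg ht0]
      have hk : ‖(t : ℂ) * ζ‖ ≤ k * (r / 10) := by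
        rw [hnz, ht, div_mul_eq_mul_div, div_le_iff₀ (by positivity)]
        push_cast at hζ
        nlinarith [mul_le_mul_of_nonneg_left hζ (Nat.cast_nonneg (α := ℝ) k)]
      have hle : ‖(t : ℂ) * ζ‖ ≤ R := by
        rw [hnz]; nlinarith [norm_nonneg ζ]
      have hd : ‖ζ - t * ζ‖ ≤ r / 10 := by
        have e : ζ - t * ζ = ((1 - t : ℝ) : ℂ) * ζ := by push_cast; ring
        rw [e, norm_mul, Complex.norm_real, Real.norm_of_nonneg (by linarith)]
        have e2 : 1 - t = 1 / (k + 1) := by rw [ht]; field_simp; ring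
        rw [e2, div_mul_eq_mul_div, div_le_iff₀ (by positivity)]
        push_cast at hζ
        linarith
      have h1 := hB f hf hb h0 (t * ζ) (by simpa using hle) hk
      have h2 := norm_le_of_spherical hf hC hr hCr (z := t * ζ) (ζ := ζ) (fun x hx => hb x (by
        rw [mem_ball_iff_norm] at hx
        rw [mem_ball_zero_iff]
        calc ‖x‖ = ‖(x - t * ζ) + t * ζ‖ := by simp
          _ ≤ ‖x - t * ζ‖ + ‖t * ζ‖ := norm_add_le _ _
          _ < R + r := by linarith)) hd
      refine h2.trans ?_
      gcongr
  obtain ⟨k, hk⟩ := exists_nat_ge (R / (r / 10))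
  obtain ⟨B, hB⟩ := main k
  refine ⟨B, fun f hf hb h0 ζ hζ => hB f hf hb h0 ζ hζ ?_⟩
  rw [div_le_iff₀ (by positivity)] at hk
  exact (mem_closedBall_zero_iff.1 hζ).trans hk

end Growth

/-- **Montel's theorem**: a locally uniformly bounded sequence of entire functions has a subsequence
converging locally uniformly. -/
theorem exists_subseq_tendstoLocallyUniformlyOn {F : ℕ → ℂ → ℂ} {U : Set ℂ} (hU : IsOpen U)
    (hF : ∀ n, Differentiable ℂ (F n))
    (hb : ∀ K ⊆ U, IsCompact K → ∃ M : ℝ, ∀ n, ∀ z ∈ K, ‖F n z‖ ≤ M) :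
    ∃ φ : ℕ → ℕ, StrictMono φ ∧ ∃ g : ℂ → ℂ,
      TendstoLocallyUniformlyOn (fun n => F (φ n)) g atTop U := by
  have hloc : ∀ x : U, ∃ δ > 0, ∃ L > 0, ∀ n, ‖F n x‖ ≤ L ∧ ∀ y : U, dist y x < δ →
      dist (F n y) (F n x) ≤ L * dist y x := by
    rintro ⟨x, hx⟩
    obtain ⟨δ, hδ, hδU⟩ := Metric.nhds_basis_closedBall.mem_iff.1 (hU.mem_nhds hx)
    obtain ⟨M, hM⟩ := hb _ hδU (isCompact_closedBall x δ)
    have hM0 : 0 ≤ M := (norm_nonneg _).trans (hM 0 x (Metric.mem_closedBall_self hδ.le))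
    refine ⟨δ, hδ, max M ((2 * M + 1) / δ), lt_max_of_lt_right (by positivity), fun n =>
      ⟨(hM n x (Metric.mem_closedBall_self hδ.le)).trans (le_max_left _ _), ?_⟩⟩
    rintro ⟨y, hy⟩ hyx
    have h1 := Complex.dist_le_div_mul_dist_of_mapsTo_ball (f := F n) (c := x) (z := y)
      (R₁ := δ) (R₂ := 2 * M + 1) (hF n).differentiableOn (fun z hz => by
        have h1 := hM n z (Metric.ball_subset_closedBall hz)
        have h2 := hM n x (Metric.mem_closedBall_self hδ.le)
        rw [mem_closedBall_iff_norm]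
        linarith [norm_sub_le (F n z) (F n x)]) hyx
    exact h1.trans (mul_le_mul_of_nonneg_right (le_max_right _ _) dist_nonneg)
  choose δ hδ L hL hFL using hloc
  let S : Set C(U, ℂ) := {f | ∀ x, ‖f x‖ ≤ L x ∧ ∀ y, dist y x < δ x →
    dist (f y) (f x) ≤ L x * dist y x}
  have hequi : ∀ x : U, ∀ ε > 0, ∀ᶠ y in 𝓝 x, dist y x < δ x ∧ L x * dist y x < ε := by
    intro x ε hε
    have h1 : Tendsto (fun y : U => dist y x) (𝓝 x) (𝓝 0) :=
      tendsto_iff_dist_tendsto_zero.1 tendsto_id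
    have h2 : Tendsto (fun y : U => L x * dist y x) (𝓝 x) (𝓝 0) := by
      simpa using h1.const_mul (L x)
    exact (h1.eventually (gt_mem_nhds (hδ x))).and (h2.eventually (gt_mem_nhds hε))
  have hS1 : IsCompact (ContinuousMap.toFun '' S) := by
    have e : ContinuousMap.toFun '' S = {f : U → ℂ | ∀ x, ‖f x‖ ≤ L x ∧ ∀ y, dist y x < δ x →
        dist (f y) (f x) ≤ L x * dist y x} := by
      ext f
      constructor
      · rintro ⟨f, hf, rfl⟩
        exact hf
      · intro hf
        refine ⟨⟨f, continuous_iff_continuousAt.2 fun x => ?_⟩, hf, rfl⟩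
        rw [ContinuousAt, Metric.tendsto_nhds]
        intro ε hε
        filter_upwards [hequi x ε hε] with y hy using ((hf x).2 y hy.1).trans_lt hy.2
    rw [e]
    refine IsCompact.of_isClosed_subset
      (isCompact_univ_pi fun x => isCompact_closedBall (0 : ℂ) (L x)) ?_ ?_
    · simp only [Set.ofPred_forall, Set.ofPred_and]
      refine isClosed_iInter fun x => (isClosed_le (by fun_prop) (by fun_prop)).inter
        (isClosed_iInter fun y => isClosed_iInter fun _ => isClosed_le (by fun_prop) (by fun_prop))
    · intro f hf x _
      simpa using (hf x).1
  have hS2 : Equicontinuous ((↑) : S → U → ℂ) := by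
    intro x
    rw [Metric.equicontinuousAt_iff_right]
    intro ε hε
    filter_upwards [hequi x ε hε] with y hy f
    rw [dist_comm]
    exact ((f.2 x).2 y hy.1).trans_lt hy.2
  have hlc : LocallyCompactSpace U := hU.locallyCompactSpace
  have hS := (ArzelaAscoli.isCompact_of_equicontinuous S hS1 hS2).isSeqCompact
  let G : ℕ → C(U, ℂ) := fun n => ⟨fun x => F n x, by have := (hF n).continuous; fun_prop⟩
  classical
  obtain ⟨g, -, φ, hφ, hg⟩ := hS (x := G) fun n x => hFL x n
  refine ⟨φ, hφ, fun z => if h : z ∈ U then g ⟨z, h⟩ else 0, ?_⟩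
  rw [ContinuousMap.tendsto_iff_tendstoLocallyUniformly] at hg
  rw [tendstoLocallyUniformlyOn_iff_tendstoLocallyUniformly_comp_coe]
  refine hg.congr_right ?_
  intro x
  simp

/-- A family of entire functions with spherical derivatives bounded near `z₀` is normal at `z₀`
(the easy half of Marty's criterion). -/
theorem isNormalAt_of_spherical {𝓕 : Set (ℂ → ℂ)} {z₀ : ℂ} {r₀ C : ℝ}
    (h𝓕 : ∀ f ∈ 𝓕, Differentiable ℂ f) (hr₀ : 0 < r₀) (hC : 0 < C)
    (hb : ∀ f ∈ 𝓕, ∀ ζ ∈ Metric.ball z₀ r₀, ‖deriv f ζ‖ ≤ C * (1 + ‖f ζ‖ ^ 2)) :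
    IsNormalAt 𝓕 Set.univ z₀ := by
  set r := min r₀ (1 / (6 * C)) with hrdef
  have hr : 0 < r := lt_min hr₀ (by positivity)
  have hCr : 6 * C * r ≤ 1 := by
    have : r ≤ 1 / (6 * C) := min_le_right _ _
    rwa [le_div_iff₀ (by positivity), mul_comm] at this
  have hb' : ∀ f ∈ 𝓕, ∀ ζ ∈ Metric.ball z₀ r, ‖deriv f ζ‖ ≤ C * (1 + ‖f ζ‖ ^ 2) :=
    fun f hf ζ hζ => hb f hf ζ (Metric.ball_subset_ball (min_le_left _ _) hζ)
  refine ⟨Metric.ball z₀ (r / 10), Metric.isOpen_ball, Metric.mem_ball_self (by positivity),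
    Set.subset_univ _, fun f hf => ?_⟩
  have hmem : ∀ ζ ∈ Metric.ball z₀ (r / 10), ‖ζ - z₀‖ ≤ r / 10 := fun ζ hζ =>
    (mem_ball_iff_norm.1 hζ).le
  by_cases hM : ∃ M : ℝ, ∃ᶠ n in atTop, ‖f n z₀‖ ≤ M
  · obtain ⟨M, hM⟩ := hM
    obtain ⟨φ, hφ, hφM⟩ := extraction_of_frequently_atTop hM
    obtain ⟨ψ, hψ, g, hg⟩ := exists_subseq_tendstoLocallyUniformlyOn
      (F := fun n => f (φ n)) (U := Metric.ball z₀ (r / 10)) Metric.isOpen_ball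
      (fun n => h𝓕 _ (hf _)) (fun K hK _ => ⟨2 + 3 * M ^ 3, fun n z hz => by
        refine (norm_le_of_spherical (h𝓕 _ (hf (φ n))) hC hr hCr (hb' _ (hf _))
          (hmem z (hK hz))).trans ?_
        have := hφM n
        gcongr⟩)
    exact ⟨φ ∘ ψ, hφ.comp hψ, Or.inl ⟨g, hg.differentiableOn
      (Eventually.of_forall fun n => (h𝓕 _ (hf _)).differentiableOn) Metric.isOpen_ball, hg⟩⟩
  · push Not at hM
    refine ⟨id, strictMono_id, Or.inr fun M K hK _ => ?_⟩
    filter_upwards [hM (max 1 (3 * (|M| + 1) ^ 3))] with n hn z hz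
    have hn1 : 1 ≤ ‖f n z₀‖ := (le_max_left _ _).trans hn.le
    have h1 := sq_le_of_spherical (h𝓕 _ (hf n)) hC hr hCr (hb' _ (hf n)) hn1 (hmem z (hK hz))
    have hn2 : 3 * (|M| + 1) ^ 3 < ‖f n z₀‖ := (le_max_right _ _).trans_lt hn
    by_contra! h
    have h2 : ‖f n z‖ ≤ |M| + 1 := by
      have := le_abs_self M
      simp only [id] at h
      linarith
    have h3 : 3 * ‖f n z‖ ^ 3 ≤ 3 * (|M| + 1) ^ 3 := by gcongr
    nlinarith

/-- A sequence of entire functions whose spherical derivative attains the value `1` at the origin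
and is at most `2` on discs exhausting the plane has a nonconstant locally uniform limit function.
-/
theorem exists_subseq_tendsto_of_spherical {G : ℕ → ℂ → ℂ} (hG : ∀ n, Differentiable ℂ (G n))
    (hb : ∀ n : ℕ, ∀ ζ, ‖ζ‖ ≤ n + 1 → ‖deriv (G n) ζ‖ ≤ 2 * (1 + ‖G n ζ‖ ^ 2))
    (h0 : ∀ n, ‖deriv (G n) 0‖ = 1 + ‖G n 0‖ ^ 2) :
    ∃ φ : ℕ → ℕ, StrictMono φ ∧ ∃ g : ℂ → ℂ, Differentiable ℂ g ∧ deriv g 0 ≠ 0 ∧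
      TendstoLocallyUniformlyOn (fun n => G (φ n)) g atTop Set.univ := by
  have hG0 : ∀ n, ‖G n 0‖ ≤ 43200 := by
    intro n
    rcases le_total ‖G n 0‖ 1 with h | h
    · linarith
    · have := norm_le_of_sq_le_norm_deriv (hG n) (C := 2) (r := 1 / 12) (z := 0) (c := 1)
        (by norm_num) (by norm_num) (by norm_num) (fun ζ hζ => hb n ζ (by
          have := mem_ball_zero_iff.1 hζ
          have : (0 : ℝ) ≤ n := n.cast_nonneg
          linarith)) h one_pos (by rw [h0]; linarith)
      norm_num at this
      exact this
  obtain ⟨φ, hφ, g, hg⟩ := exists_subseq_tendstoLocallyUniformlyOn isOpen_univ hG (by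
    intro K _ hK
    obtain ⟨R, hR⟩ := hK.isBounded.subset_closedBall 0
    obtain ⟨B, hB⟩ := exists_bound_of_spherical (C := 2) (r := 1 / 12) (by norm_num)
      (by norm_num) (by norm_num) 43200 R
    obtain ⟨N, hN⟩ := exists_nat_ge R
    have hcont : ∀ n, ∃ M : ℝ, ∀ z ∈ K, ‖G n z‖ ≤ M := fun n =>
      hK.exists_bound_of_continuousOn (hG n).continuous.continuousOn
    choose M hM using hcont
    obtain ⟨A, hA⟩ := ((Finset.range N).image M).bddAbove
    refine ⟨max A B, fun n z hz => ?_⟩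
    rcases lt_or_ge n N with h | h
    · refine (hM n z hz).trans ((hA ?_).trans (le_max_left _ _))
      simpa using ⟨n, h, rfl⟩
    · refine (hB (G n) (hG n) (fun ζ hζ => hb n ζ ?_) (hG0 n) z (hR hz)).trans (le_max_right _ _)
      have h1 := mem_ball_zero_iff.1 hζ
      have h2 : (N : ℝ) ≤ n := by exact_mod_cast h
      linarith)
  refine ⟨φ, hφ, g, ?_, ?_, hg⟩
  · rw [← differentiableOn_univ]
    exact hg.differentiableOn (Eventually.of_forall fun n => (hG _).differentiableOn) isOpen_univ
  · have h1 := (hg.deriv (Eventually.of_forall fun n => (hG _).differentiableOn)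
      isOpen_univ).tendsto_at (Set.mem_univ 0)
    have h2 : 1 ≤ ‖deriv g 0‖ := ge_of_tendsto h1.norm (Eventually.of_forall fun n => by
      simp only [Function.comp, h0]
      linarith [sq_nonneg ‖G (φ n) 0‖])
    intro h
    rw [h, norm_zero] at h2
    linarith

/-- **Zalcman's rescaling lemma** for families of entire functions. -/
theorem exists_rescaling_of_not_isNormalAt {𝓕 : Set (ℂ → ℂ)} {z₀ : ℂ}
    (h𝓕 : ∀ f ∈ 𝓕, Differentiable ℂ f) (hz₀ : ¬ IsNormalAt 𝓕 Set.univ z₀) :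
    ∃ (h : ℕ → ℂ → ℂ) (y : ℕ → ℂ) (ρ : ℕ → ℝ) (g : ℂ → ℂ), (∀ n, h n ∈ 𝓕) ∧ (∀ n, 0 < ρ n) ∧
      Tendsto y atTop (𝓝 z₀) ∧ Tendsto ρ atTop (𝓝 0) ∧ Differentiable ℂ g ∧ deriv g 0 ≠ 0 ∧
      TendstoLocallyUniformlyOn (fun n ζ => h n (y n + ρ n * ζ)) g atTop Set.univ := by
  have key : ∀ n : ℕ, ∃ h ∈ 𝓕, ∃ y : ℂ, ∃ ρ > 0, dist y z₀ ≤ 3 * (1 / ((n : ℝ) + 1)) ∧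
      ρ ≤ 1 / ((n : ℝ) + 1) ∧
      (∀ ζ : ℂ, ‖ζ‖ ≤ n + 1 → ρ * ‖deriv h (y + ρ * ζ)‖ ≤ 2 * (1 + ‖h (y + ρ * ζ)‖ ^ 2)) ∧
      ρ * ‖deriv h y‖ = 1 + ‖h y‖ ^ 2 := by
    intro n
    set ε : ℝ := 1 / ((n : ℝ) + 1) with hεdef
    have hε : 0 < ε := by positivity
    have hn : ((n : ℝ) + 1) * ε = 1 := by rw [hεdef]; field_simp
    obtain ⟨h, hh, x, hx, hhx⟩ : ∃ h ∈ 𝓕, ∃ x ∈ Metric.ball z₀ ε,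
        ((n : ℝ) + 1) ^ 2 * (1 + ‖h x‖ ^ 2) < ‖deriv h x‖ := by
      by_contra! hcon
      exact hz₀ (isNormalAt_of_spherical h𝓕 hε (by positivity) hcon)
    have hd := h𝓕 h hh
    have hcd : Continuous (deriv h) := (hd.contDiff (n := 1)).continuous_deriv le_rfl
    set ϕ : ℂ → ℝ := fun x => ‖deriv h x‖ / (1 + ‖h x‖ ^ 2) with hϕ
    have hpos : ∀ x, 0 < 1 + ‖h x‖ ^ 2 := fun x => by positivity
    have hcont : Continuous ϕ := by
      have := hd.continuous
      exact hcd.norm.div (by fun_prop) fun x => (hpos x).ne'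
    obtain ⟨ε', hε', y, hε'ε, hy, hle, hmax⟩ := hofer x ε hε hcont (fun y => by positivity)
    have hϕx : ((n : ℝ) + 1) ^ 2 < ϕ x := by rwa [hϕ, lt_div_iff₀ (hpos x)]
    have h1 : (n : ℝ) + 1 < ε' * ϕ y := by
      refine lt_of_lt_of_le ?_ hle
      nlinarith
    have hϕy : 0 < ϕ y := by
      by_contra! hc
      nlinarith [n.cast_nonneg (α := ℝ)]
    have h2 : ((n : ℝ) + 1) / ϕ y ≤ ε' := by
      rw [div_le_iff₀ hϕy]; exact h1.le
    refine ⟨h, hh, y, 1 / ϕ y, by positivity, ?_, ?_, ?_, ?_⟩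
    · have := dist_triangle y x z₀
      have := Metric.mem_ball.1 hx
      linarith
    · rw [div_le_iff₀ hϕy]
      nlinarith [n.cast_nonneg (α := ℝ)]
    · intro ζ hζ
      have := hmax (y + (1 / ϕ y : ℝ) * ζ) (by
        rw [dist_self_add_right, norm_mul, Complex.norm_real, Real.norm_of_nonneg (by positivity)]
        refine le_trans ?_ h2
        rw [div_mul_eq_mul_div, one_mul]
        gcongr)
      have h3 : ‖deriv h (y + (1 / ϕ y : ℝ) * ζ)‖ ≤
          2 * ϕ y * (1 + ‖h (y + (1 / ϕ y : ℝ) * ζ)‖ ^ 2) := by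
        rwa [← div_le_iff₀ (hpos _)]
      rw [div_mul_eq_mul_div, one_mul, div_le_iff₀ hϕy]
      linarith
    · have : ϕ y * (1 + ‖h y‖ ^ 2) = ‖deriv h y‖ := div_mul_cancel₀ _ (hpos y).ne'
      rw [← this]
      field_simp
  choose h hh y ρ hρ hy hρn hb h0 using key
  have hd : ∀ n ζ, HasDerivAt (fun ζ => h n (y n + ρ n * ζ))
      (deriv (h n) (y n + ρ n * ζ) * ρ n) ζ := by
    intro n ζ
    have h1 : HasDerivAt (fun ζ : ℂ => y n + ρ n * ζ) (ρ n) ζ := by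
      simpa using ((hasDerivAt_id ζ).const_mul (ρ n : ℂ)).const_add (y n)
    exact ((h𝓕 _ (hh n)) _).hasDerivAt.comp_of_eq ζ h1 rfl
  have hnd : ∀ n ζ, ‖deriv (fun ζ => h n (y n + ρ n * ζ)) ζ‖ =
      ρ n * ‖deriv (h n) (y n + ρ n * ζ)‖ := by
    intro n ζ
    rw [(hd n ζ).deriv, norm_mul, Complex.norm_real, Real.norm_of_nonneg (hρ n).le, mul_comm]
  obtain ⟨φ, hφ, g, hg, hg0, hlim⟩ := exists_subseq_tendsto_of_spherical
    (G := fun n ζ => h n (y n + ρ n * ζ)) (fun n ζ => (hd n ζ).differentiableAt)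
    (fun n ζ hζ => by rw [hnd]; exact hb n ζ hζ) (fun n => by simpa [hnd] using h0 n)
  have hlim0 := tendsto_one_div_add_atTop_nhds_zero_nat (𝕜 := ℝ)
  have hyt : Tendsto y atTop (𝓝 z₀) := tendsto_iff_dist_tendsto_zero.2
    (squeeze_zero (fun _ => dist_nonneg) hy (by simpa using hlim0.const_mul 3))
  have hρt : Tendsto ρ atTop (𝓝 0) := squeeze_zero (fun n => (hρ n).le) hρn hlim0
  exact ⟨h ∘ φ, y ∘ φ, ρ ∘ φ, g, fun n => hh _, fun n => hρ _, hyt.comp hφ.tendsto_atTop,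
    hρt.comp hφ.tendsto_atTop, hg, hg0, hlim⟩

/-- Two entire functions can be divided if the orders of vanishing permit it. -/
theorem exists_entire_mul_eq {a b : ℂ → ℂ} (ha : Differentiable ℂ a) (hb : Differentiable ℂ b)
    (hb0 : ∀ z, analyticOrderAt b z ≠ ⊤) (hab : ∀ z, analyticOrderAt b z ≤ analyticOrderAt a z) :
    ∃ G : ℂ → ℂ, Differentiable ℂ G ∧ ∀ z, a z = G z * b z := by
  have hm : MeromorphicOn (a / b) Set.univ := fun z _ =>
    (ha.analyticAt z).meromorphicAt.div (hb.analyticAt z).meromorphicAt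
  set G := toMeromorphicNFOn (a / b) Set.univ with hGdef
  have hG : ∀ z, AnalyticAt ℂ G z := by
    intro z
    have hnf : MeromorphicNFAt G z := meromorphicNFOn_toMeromorphicNFOn (a / b) Set.univ
      (Set.mem_univ z)
    rw [← hnf.meromorphicOrderAt_nonneg_iff_analyticAt, hGdef,
      meromorphicOrderAt_toMeromorphicNFOn hm (Set.mem_univ z),
      meromorphicOrderAt_div (ha.analyticAt z).meromorphicAt (hb.analyticAt z).meromorphicAt,
      (ha.analyticAt z).meromorphicOrderAt_eq, (hb.analyticAt z).meromorphicOrderAt_eq]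
    have h1 := hb0 z
    have h2 := hab z
    cases hB : analyticOrderAt b z with
    | top => exact absurd hB h1
    | coe n =>
      cases hA : analyticOrderAt a z with
      | top => simp
      | coe m =>
        rw [hA, hB] at h2
        have h3 : (n : ℤ) ≤ m := by exact_mod_cast h2
        simp only [ENat.map_natCast]
        rw [← WithTop.LinearOrderedAddCommGroup.coe_sub]
        exact_mod_cast sub_nonneg.2 h3
  refine ⟨G, fun z => (hG z).differentiableAt, fun z => ?_⟩
  have h1 : ∀ᶠ x in 𝓝[≠] z, b x ≠ 0 := by
    rcases (hb.analyticAt z).eventually_eq_zero_or_eventually_ne_zero with h | h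
    · exact absurd (analyticOrderAt_eq_top.2 h) (hb0 z)
    · exact h
  have h2 : ∀ᶠ x in 𝓝[≠] z, G x = (a / b) x :=
    by
    filter_upwards [hm.toMeromorphicNFOn_eq_self_on_nhdsNE (Set.mem_univ z)] with x hx using hx
  have h3 : a =ᶠ[𝓝[≠] z] fun x => G x * b x := by
    filter_upwards [h1, h2] with x hx1 hx2
    rw [hx2, Pi.div_apply, div_mul_cancel₀ _ hx1]
  exact ((ha.continuous.continuousAt.eventuallyEq_nhds_iff_eventuallyEq_nhdsNE
    ((hG z).continuousAt.mul hb.continuous.continuousAt)).1 h3).eq_of_nhds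

/-- A nonconstant entire function all of whose preimages of the zeros of `P` are critical points
satisfies a first and a second order differential equation. -/
theorem exists_differential_equation {g : ℂ → ℂ} (hg : Differentiable ℂ g) {x : ℂ}
    (hx : deriv g x ≠ 0) {P : Polynomial ℂ} (hP : P.Separable)
    (hcrit : ∀ z, P.eval (g z) = 0 → deriv g z = 0) :
    ∃ G : ℂ → ℂ, Differentiable ℂ G ∧ (∀ z, deriv g z ^ 2 = G z * P.eval (g z)) ∧
      ∀ z, 2 * G z * deriv (deriv g) z =
        deriv G z * deriv g z + G z ^ 2 * P.derivative.eval (g z) := by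
  have hg' : Differentiable ℂ (deriv g) := hg.deriv
  have hPg : Differentiable ℂ fun z => P.eval (g z) := P.differentiable.comp hg
  have hana : AnalyticOnNhd ℂ (fun z => P.eval (g z)) Set.univ := fun z _ => hPg.analyticAt z
  have hx0 : P.eval (g x) ≠ 0 := fun h => hx (hcrit x h)
  have htop : ∀ z, analyticOrderAt (fun z => P.eval (g z)) z ≠ ⊤ := by
    intro z hz
    rw [analyticOrderAt_eq_top] at hz
    exact hx0 (hana.eqOn_zero_of_preconnected_of_eventuallyEq_zero isPreconnected_univ
      (Set.mem_univ z) hz (Set.mem_univ x))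
  obtain ⟨G, hG, hGe⟩ := exists_entire_mul_eq (a := fun z => deriv g z ^ 2)
    (b := fun z => P.eval (g z)) (hg'.pow 2) hPg htop (by
      intro z
      by_cases hz : P.eval (g z) = 0
      · obtain ⟨Q, hQ⟩ := Polynomial.dvd_iff_isRoot.2 hz
        have hQ0 : Q.eval (g z) ≠ 0 := by
          intro h
          have h1 : P.derivative.eval (g z) ≠ 0 := by
            have := hP.eval₂_derivative_ne_zero (RingHom.id ℂ) (x := g z) (by simpa using hz)
            simpa using this
          apply h1
          rw [hQ]
          simp [Polynomial.derivative_mul, h]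
        have e : (fun z => P.eval (g z)) = (fun w => g w - g z) * fun w => Q.eval (g w) := by
          ext w
          rw [hQ]
          simp
        have hQg : AnalyticAt ℂ (fun w => Q.eval (g w)) z :=
          (Q.differentiable.comp hg).analyticAt z
        have e2 : (fun z => deriv g z ^ 2) = (deriv g) ^ 2 := rfl
        rw [e, analyticOrderAt_mul ((hg.analyticAt z).fun_sub analyticAt_const) hQg,
          hQg.analyticOrderAt_eq_zero.2 hQ0, add_zero,
          ← (hg.analyticAt z).analyticOrderAt_deriv_add_one, e2,
          analyticOrderAt_pow (hg'.analyticAt z), two_nsmul]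
        gcongr
        rw [Order.one_le_iff_ne_zero]
        exact (hg'.analyticAt z).analyticOrderAt_ne_zero.2 (hcrit z hz)
      · rw [(hPg.analyticAt z).analyticOrderAt_eq_zero.2 hz]
        exact zero_le)
  refine ⟨G, hG, hGe, fun z => ?_⟩
  have hG' : Differentiable ℂ (deriv G) := hG.deriv
  have hg'' : Differentiable ℂ (deriv (deriv g)) := hg'.deriv
  have hP'g : Differentiable ℂ fun z => P.derivative.eval (g z) := P.derivative.differentiable.comp hg
  have h1 : ∀ᶠ x in 𝓝[≠] z, P.eval (g x) ≠ 0 := by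
    rcases (hPg.analyticAt z).eventually_eq_zero_or_eventually_ne_zero with h | h
    · exact absurd (analyticOrderAt_eq_top.2 h) (htop z)
    · exact h
  have hd : ∀ w, 2 * deriv g w * deriv (deriv g) w = deriv G w * P.eval (g w) +
      G w * (P.derivative.eval (g w) * deriv g w) := by
    intro w
    have d1 := (hg' w).hasDerivAt.pow 2
    have d2 := (hG w).hasDerivAt.mul ((P.hasDerivAt (g w)).comp w (hg w).hasDerivAt)
    have e : deriv g ^ 2 = G * ((fun x => P.eval x) ∘ g) := by
      ext w; exact hGe w
    rw [e] at d1
    have := d1.unique d2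
    simpa using this
  have h3 : (fun w => 2 * G w * deriv (deriv g) w) =ᶠ[𝓝[≠] z] fun w =>
      deriv G w * deriv g w + G w ^ 2 * P.derivative.eval (g w) := by
    filter_upwards [h1] with w hw
    apply mul_right_cancel₀ hw
    have e1 := hd w
    have e2 := hGe w
    linear_combination (-2 * deriv (deriv g) w + G w * P.derivative.eval (g w)) * e2
      + deriv g w * e1
  have c1 : Continuous fun w => 2 * G w * deriv (deriv g) w :=
    (continuous_const.mul hG.continuous).mul hg''.continuous
  have c2 : Continuous fun w => deriv G w * deriv g w + G w ^ 2 * P.derivative.eval (g w) :=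
    (hG'.continuous.mul hg'.continuous).add ((hG.continuous.pow 2).mul hP'g.continuous)
  exact ((c1.continuousAt.eventuallyEq_nhds_iff_eventuallyEq_nhdsNE
    c2.continuousAt).1 h3).eq_of_nhds

open Metric in
/-- Solutions of the differential equation `g' ^ 2 = G * P(g)` with `P` quartic do not admit
normalised `G` bounded on large discs. -/
theorem exists_radius_of_differential_equation {P : Polynomial ℂ} {A : ℝ} (hA : 1 ≤ A)
    (hup : ∀ w, ‖P.eval w‖ ≤ 4 * A ^ 4 * (1 + ‖w‖ ^ 2) ^ 2)
    (hlow : ∀ w, 2 * A ≤ ‖w‖ → ‖w‖ ^ 4 ≤ 16 * ‖P.eval w‖) (hP : P.Separable) :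
    ∃ R > 0, ∀ g G : ℂ → ℂ, Differentiable ℂ g → Differentiable ℂ G →
      (∀ z, deriv g z ^ 2 = G z * P.eval (g z)) →
      (∀ z, 2 * G z * deriv (deriv g) z =
        deriv G z * deriv g z + G z ^ 2 * P.derivative.eval (g z)) →
      ‖G 0‖ = 1 → (∀ z, ‖z‖ ≤ R → ‖G z‖ ≤ 4) → False := by
  have hA0 : 0 < A := by linarith
  set r : ℝ := 1 / (24 * A ^ 2) with hr
  have hr0 : 0 < r := by positivity
  have hCr : 6 * (4 * A ^ 2) * r ≤ 1 := by
    rw [hr]; field_simp; norm_num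
  set M : ℝ := max (2 * A) (300 / (r * (1 / 6)) ^ 2) with hM
  have hM0 : 0 < M := lt_max_of_lt_left (by positivity)
  obtain ⟨η, hη, hηP⟩ : ∃ η > 0, ∀ w : ℂ, ‖w‖ ≤ M → η ≤ ‖P.eval w‖ + ‖P.derivative.eval w‖ := by
    obtain ⟨w₁, -, hw₁⟩ := (isCompact_closedBall (0 : ℂ) M).exists_isMinOn
      ⟨0, mem_closedBall_self hM0.le⟩
      (f := fun w => ‖P.eval w‖ + ‖P.derivative.eval w‖) (by fun_prop)
    refine ⟨_, ?_, fun w hw => hw₁ (mem_closedBall_zero_iff.2 hw)⟩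
    by_cases h : P.eval w₁ = 0
    · have h1 : P.derivative.eval w₁ ≠ 0 := by
        have := hP.eval₂_derivative_ne_zero (RingHom.id ℂ) (x := w₁) (by simpa using h)
        simpa using this
      positivity
    · positivity
  set K : ℝ := 256 * M ^ 2 + 2112 * M with hK
  have hK0 : 0 < K := by positivity
  set R : ℝ := max (max 1 (2 * r)) (K / η + 1) with hR
  have hR1 : 1 ≤ R := (le_max_left _ _).trans (le_max_left _ _)
  have hR0 : 0 < R := by linarith
  have hR2 : 2 * r ≤ R := (le_max_right _ _).trans (le_max_left _ _)
  have hR3 : K / η < R := lt_of_lt_of_le (by linarith) (le_max_right _ _)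
  refine ⟨R, hR0, fun g G hg hG h1 h2 hG0 hG4 => ?_⟩
  have hsph : ∀ z, ‖z‖ ≤ R → ‖deriv g z‖ ≤ 4 * A ^ 2 * (1 + ‖g z‖ ^ 2) := by
    intro z hz
    apply le_of_sq_le_sq _ (by positivity)
    rw [← norm_pow, h1, norm_mul]
    calc _ ≤ 4 * (4 * A ^ 4 * (1 + ‖g z‖ ^ 2) ^ 2) := by gcongr; exacts [hG4 z hz, hup _]
      _ = _ := by ring
  have hGhalf : ∀ z, ‖z‖ ≤ R / 16 → 1 / 2 ≤ ‖G z‖ := by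
    intro z hz
    have := Complex.dist_le_div_mul_dist_of_mapsTo_ball (f := G) (c := 0) (z := z) (R₁ := R)
      (R₂ := 5) hG.differentiableOn (fun x hx => by
        rw [mem_closedBall_iff_norm]
        have := hG4 x (mem_ball_zero_iff.1 hx).le
        linarith [norm_sub_le (G x) (G 0)]) (mem_ball_zero_iff.2 (by linarith))
    rw [dist_zero_right, dist_comm, dist_eq_norm] at this
    have e : 5 / R * ‖z‖ ≤ 5 / R * (R / 16) := by gcongr
    have e' : 5 / R * (R / 16) = 5 / 16 := by field_simp
    have := norm_sub_norm_le (G 0) (G z)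
    linarith
  have hgM : ∀ z, ‖z‖ ≤ R / 16 → ‖g z‖ ≤ M := by
    intro z hz
    by_contra! hlt
    have hlt1 : 2 * A < ‖g z‖ := (le_max_left _ _).trans_lt hlt
    have hlt2 : 300 / (r * (1 / 6)) ^ 2 < ‖g z‖ := (le_max_right _ _).trans_lt hlt
    refine absurd hlt2 (not_lt.2 ?_)
    apply norm_le_of_sq_le_norm_deriv hg (C := 4 * A ^ 2) (by positivity) hr0 hCr
    · intro ζ hζ
      apply hsph
      have := mem_ball_iff_norm.1 hζ
      have e : ζ = (ζ - z) + z := by ring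
      have := norm_add_le (ζ - z) z
      rw [← e] at this
      linarith
    · linarith
    · norm_num
    · apply le_of_sq_le_sq _ (norm_nonneg _)
      rw [← norm_pow (deriv g z), h1, norm_mul]
      have e1 := hlow _ hlt1.le
      have e2 := hGhalf z hz
      have e3 := mul_le_mul_of_nonneg_right e2 (norm_nonneg (P.eval (g z)))
      nlinarith [sq_nonneg (‖g z‖ ^ 2)]
  have hd1 : ∀ z, ‖z‖ ≤ R / 32 → ‖deriv g z‖ ≤ M / (R / 32) := by
    intro z hz
    apply Complex.norm_deriv_le_of_forall_mem_sphere_norm_le (by positivity) hg.diffContOnCl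
    intro ζ hζ
    apply hgM
    have := mem_sphere_iff_norm.1 hζ
    have e : ζ = (ζ - z) + z := by ring
    have := norm_add_le (ζ - z) z
    rw [← e] at this
    linarith
  have hd2 : ‖deriv (deriv g) 0‖ ≤ M / (R / 32) / (R / 32) := by
    apply Complex.norm_deriv_le_of_forall_mem_sphere_norm_le (by positivity)
      hg.deriv.diffContOnCl
    intro ζ hζ
    exact hd1 ζ (by simpa using (mem_sphere_iff_norm.1 hζ).le)
  have hdG : ‖deriv G 0‖ ≤ 4 / R := by
    apply Complex.norm_deriv_le_of_forall_mem_sphere_norm_le (by positivity) hG.diffContOnCl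
    intro ζ hζ
    exact hG4 ζ (by simpa using (mem_sphere_iff_norm.1 hζ).le)
  have hd0 : ‖deriv g 0‖ ≤ M / (R / 16) := by
    apply Complex.norm_deriv_le_of_forall_mem_sphere_norm_le (by positivity) hg.diffContOnCl
    intro ζ hζ
    exact hgM ζ (by simpa using (mem_sphere_iff_norm.1 hζ).le)
  have b1 : ‖P.eval (g 0)‖ ≤ (M / (R / 16)) ^ 2 := by
    have := congrArg norm (h1 0)
    rw [norm_mul, hG0, one_mul, norm_pow] at this
    rw [← this]
    gcongr
  have b2 : ‖P.derivative.eval (g 0)‖ ≤ 2 * (M / (R / 32) / (R / 32)) + 4 / R * (M / (R / 16)) := by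
    have e : G 0 ^ 2 * P.derivative.eval (g 0) =
        2 * G 0 * deriv (deriv g) 0 - deriv G 0 * deriv g 0 := by rw [h2]; ring
    have := congrArg norm e
    rw [norm_mul, norm_pow, hG0, one_pow, one_mul] at this
    rw [this]
    refine (norm_sub_le _ _).trans ?_
    rw [norm_mul, norm_mul, norm_mul, hG0, Complex.norm_ofNat, mul_one]
    gcongr
  have b3 := hηP (g 0) (hgM 0 (by simpa using by positivity))
  have e : (M / (R / 16)) ^ 2 + (2 * (M / (R / 32) / (R / 32)) + 4 / R * (M / (R / 16))) =
      K / R ^ 2 := by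
    rw [hK]
    field_simp
    ring
  have b4 : K / R ^ 2 < η := by
    rw [div_lt_iff₀ hη] at hR3
    rw [div_lt_iff₀ (by positivity)]
    nlinarith
  linarith

/-- A nonconstant entire function has at most three totally ramified values. -/
theorem exists_simple_preimage {g : ℂ → ℂ} (hg : Differentiable ℂ g) {x : ℂ}
    (hx : deriv g x ≠ 0) {u : Fin 4 → ℂ} (hu : Function.Injective u) :
    ∃ i z, g z = u i ∧ deriv g z ≠ 0 := by
  by_contra! hcon
  set P : Polynomial ℂ := ∏ i, (Polynomial.X - Polynomial.C (u i)) with hPdef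
  have hP : P.Separable := Polynomial.separable_prod_X_sub_C_iff.2 hu
  have hPe : ∀ w, P.eval w = ∏ i, (w - u i) := fun w => by simp [hPdef, Polynomial.eval_prod]
  obtain ⟨A, hA1, hAu⟩ : ∃ A : ℝ, 1 ≤ A ∧ ∀ i, ‖u i‖ ≤ A := by
    obtain ⟨B, hB⟩ := (Set.finite_range fun i => ‖u i‖).bddAbove
    exact ⟨max 1 B, le_max_left _ _, fun i => (hB ⟨i, rfl⟩).trans (le_max_right _ _)⟩
  have hup : ∀ w, ‖P.eval w‖ ≤ 4 * A ^ 4 * (1 + ‖w‖ ^ 2) ^ 2 := by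
    intro w
    have h1 : ‖P.eval w‖ ≤ (A * (1 + ‖w‖)) ^ 4 := by
      rw [hPe, norm_prod]
      have := Finset.prod_le_prod (s := Finset.univ) (f := fun i => ‖w - u i‖)
        (g := fun _ : Fin 4 => A * (1 + ‖w‖)) (fun i _ => norm_nonneg _) (fun i _ => by
          have := norm_sub_le w (u i)
          nlinarith [hAu i, norm_nonneg w])
      simpa using this
    have h2 : (1 + ‖w‖) ^ 2 ≤ 2 * (1 + ‖w‖ ^ 2) := by nlinarith [sq_nonneg (1 - ‖w‖)]
    calc _ ≤ _ := h1
      _ = A ^ 4 * ((1 + ‖w‖) ^ 2) ^ 2 := by ring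
      _ ≤ A ^ 4 * (2 * (1 + ‖w‖ ^ 2)) ^ 2 := by gcongr
      _ = _ := by ring
  have hlow : ∀ w, 2 * A ≤ ‖w‖ → ‖w‖ ^ 4 ≤ 16 * ‖P.eval w‖ := by
    intro w hw
    have h1 : (‖w‖ / 2) ^ 4 ≤ ‖P.eval w‖ := by
      rw [hPe, norm_prod]
      have := Finset.prod_le_prod (s := Finset.univ) (g := fun i => ‖w - u i‖)
        (f := fun _ : Fin 4 => ‖w‖ / 2) (fun i _ => by positivity) (fun i _ => by
          have := norm_sub_norm_le w (u i)
          linarith [hAu i])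
      simpa [div_pow] using this
    linarith [show (‖w‖ / 2) ^ 4 = ‖w‖ ^ 4 / 16 by ring]
  obtain ⟨R, hR, hfin⟩ := exists_radius_of_differential_equation hA1 hup hlow hP
  obtain ⟨G, hG, h1, h2⟩ := exists_differential_equation hg hx hP (fun z hz => by
    rw [hPe, Finset.prod_eq_zero_iff] at hz
    obtain ⟨i, -, hi⟩ := hz
    exact hcon i z (sub_eq_zero.1 hi))
  have hGx : 0 < √‖G x‖ := by
    apply Real.sqrt_pos.2
    rw [norm_pos_iff]
    intro h
    have := h1 x
    rw [h, zero_mul] at this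
    exact hx (pow_eq_zero_iff two_ne_zero |>.1 this)
  obtain ⟨ε, hε, y, -, -, hle, hmax⟩ := hofer x (R / √‖G x‖) (by positivity)
    (ϕ := fun z => √‖G z‖) (by have := hG.continuous; fun_prop) (fun _ => Real.sqrt_nonneg _)
  rw [div_mul_cancel₀ _ hGx.ne'] at hle
  have hs : 0 < √‖G y‖ := by
    by_contra! h
    nlinarith
  set ρ : ℝ := 1 / √‖G y‖ with hρ
  have hρ0 : 0 < ρ := by positivity
  have hρG : ρ ^ 2 * ‖G y‖ = 1 := by
    rw [hρ, div_pow, Real.sq_sqrt (norm_nonneg _), one_pow, one_div, inv_mul_cancel₀]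
    exact (Real.sqrt_pos.1 hs).ne'
  have hder : ∀ k : ℂ → ℂ, Differentiable ℂ k → ∀ c ζ : ℂ,
      HasDerivAt (fun ζ : ℂ => c * k (y + ρ * ζ)) (c * ρ * deriv k (y + ρ * ζ)) ζ := by
    intro k hk c ζ
    have e1 : HasDerivAt (fun ζ : ℂ => y + ρ * ζ) (ρ : ℂ) ζ := by
      simpa using ((hasDerivAt_id ζ).const_mul (ρ : ℂ)).const_add y
    have e2 := ((hk (y + ρ * ζ)).hasDerivAt.comp_of_eq ζ e1 rfl).const_mul c
    convert! e2 using 1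
    ring
  have hdg : deriv (fun ζ => g (y + ρ * ζ)) = fun ζ => ρ * deriv g (y + ρ * ζ) := by
    ext ζ
    have := (hder g hg 1 ζ).deriv
    simpa using this
  have hdG : deriv (fun ζ : ℂ => (ρ : ℂ) ^ 2 * G (y + ρ * ζ)) =
      fun ζ => ρ ^ 3 * deriv G (y + ρ * ζ) := by
    ext ζ
    rw [(hder G hG _ ζ).deriv]
    ring
  have hddg : deriv (fun ζ : ℂ => (ρ : ℂ) * deriv g (y + ρ * ζ)) =
      fun ζ => ρ ^ 2 * deriv (deriv g) (y + ρ * ζ) := by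
    ext ζ
    rw [(hder _ hg.deriv _ ζ).deriv]
    ring
  refine hfin (fun ζ => g (y + ρ * ζ)) (fun ζ => ρ ^ 2 * G (y + ρ * ζ))
    (hg.comp (by fun_prop)) (fun ζ => (hder G hG _ ζ).differentiableAt) ?_ ?_ ?_ ?_
  · intro z
    rw [hdg]
    linear_combination (ρ : ℂ) ^ 2 * h1 (y + ρ * z)
  · intro z
    rw [hdg, hddg, hdG]
    linear_combination (ρ : ℂ) ^ 4 * h2 (y + ρ * z)
  · simpa [abs_of_pos hρ0] using hρG
  · intro z hz
    have h3 := hmax (y + ρ * z) (by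
      rw [dist_self_add_right, norm_mul, Complex.norm_real, Real.norm_of_nonneg hρ0.le, hρ,
        div_mul_eq_mul_div, one_mul, div_le_iff₀ hs]
      linarith)
    have h4 : ‖G (y + ρ * z)‖ ≤ 4 * ‖G y‖ := by
      have := pow_le_pow_left₀ (Real.sqrt_nonneg _) h3 2
      rw [mul_pow, Real.sq_sqrt (norm_nonneg _), Real.sq_sqrt (norm_nonneg _)] at this
      linarith
    rw [norm_mul, norm_pow, Complex.norm_real, Real.norm_of_nonneg hρ0.le]
    nlinarith [mul_le_mul_of_nonneg_left h4 (sq_nonneg ρ)]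

open Metric ComplexConjugate in
theorem one_le_norm_canonicalFactor {R : ℝ} {i w : ℂ} (hi : i ∈ ball 0 R) (hw : w ∈ closedBall 0 R)
    (hne : w ≠ i) : 1 ≤ ‖Complex.canonicalFactor R i w‖ := by
  have hR : 0 < R := pos_of_mem_ball hi
  rw [Complex.canonicalFactor_apply, norm_div, one_le_div
    (norm_pos_iff.2 (mul_ne_zero (by exact_mod_cast hR.ne') (sub_ne_zero.2 hne)))]
  have hi' : Complex.normSq i ≤ R ^ 2 := by
    rw [Complex.normSq_eq_norm_sq]
    have := mem_ball_zero_iff.1 hi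
    gcongr
  have hw' : Complex.normSq w ≤ R ^ 2 := by
    rw [Complex.normSq_eq_norm_sq]
    have := mem_closedBall_zero_iff.1 hw
    gcongr
  rw [← sq_le_sq₀ (norm_nonneg _) (norm_nonneg _), ← Complex.normSq_eq_norm_sq,
    ← Complex.normSq_eq_norm_sq]
  simp only [Complex.normSq_apply, Complex.mul_re, Complex.mul_im, Complex.sub_re, Complex.sub_im,
    Complex.conj_re, Complex.conj_im, Complex.ofReal_re, Complex.ofReal_im, pow_two] at *
  nlinarith [mul_nonneg (sub_nonneg.2 hi') (sub_nonneg.2 hw')]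

open Metric in
theorem log_norm_le_mul_circleAverage {f : ℂ → ℂ} (hf : Differentiable ℂ f) {R : ℝ} (hR : 0 < R)
    (hs : ∀ z ∈ sphere (0 : ℂ) R, f z ≠ 0) {w : ℂ} (hw : ‖w‖ ≤ R / 2) (hfw : f w ≠ 0) :
    Real.log ‖f w‖ ≤ 3 * Real.circleAverage (fun z => max 0 (Real.log ‖f z‖)) 0 R := by
  have hana : ∀ z, AnalyticAt ℂ f z := fun z => hf.analyticAt z
  have hmer : MeromorphicOn f (closedBall 0 R) := fun z _ => (hana z).meromorphicAt
  have hord0 : ∀ z, f z ≠ 0 → meromorphicOrderAt f z = 0 := fun z hz => by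
    rw [(hana z).meromorphicOrderAt_eq, (hana z).analyticOrderAt_eq_zero.2 hz]; rfl
  have htop : ∀ u : closedBall (0 : ℂ) R, meromorphicOrderAt f u ≠ ⊤ := by
    refine fun u => (Meromorphic.exists_meromorphicOrderAt_ne_top_iff_forall
      (fun z => (hana z).meromorphicAt)).1 ⟨w, ?_⟩ u
    rw [hord0 w hfw]; simp
  obtain ⟨h, D⟩ := hmer.exists_ecanonicalDecomp htop
  have hball : ∀ z ∈ sphere (0 : ℂ) R, MeromorphicOn.divisor f (sphere 0 R) z = 0 := by
    intro z hz
    rw [MeromorphicOn.divisor_apply (fun z _ => (hana z).meromorphicAt) hz, hord0 z (hs z hz)]; rfl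
  have hsph : ∀ z, MeromorphicOn.divisor f (sphere 0 R) z = 0 := by
    intro z
    by_cases hz : z ∈ sphere (0 : ℂ) R
    · exact hball z hz
    · exact Function.locallyFinsuppWithin.apply_eq_zero_of_notMem _ hz
  have hformula : ∀ z ∈ closedBall (0 : ℂ) R, f z ≠ 0 → Real.log ‖h z‖ =
      (∑ᶠ i, (MeromorphicOn.divisor f (ball 0 R) i) *
        Real.log ‖Complex.canonicalFactor R i z‖) + Real.log ‖f z‖ := by
    intro z hz hfz
    rw [D.log_norm_eq hz (hord0 z hfz) hR, (hana z).meromorphicTrailingCoeffAt_of_ne_zero hfz]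
    simp [hsph]
  have hwb : w ∈ ball (0 : ℂ) R := by rw [mem_ball_zero_iff]; linarith
  have h1 : Real.log ‖f w‖ ≤ Real.log ‖h w‖ := by
    rw [hformula w (ball_subset_closedBall hwb) hfw]
    refine le_add_of_nonneg_left (finsum_nonneg fun i => ?_)
    by_cases hi : i ∈ ball (0 : ℂ) R
    · refine mul_nonneg ?_ ?_
      · have := MeromorphicOn.AnalyticOnNhd.divisor_nonneg (f := f) (U := ball 0 R)
          (fun z _ => hana z)
        exact_mod_cast this i
      · by_cases hne : w = i
        · simp [hne]
        · exact Real.log_nonneg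
            (one_le_norm_canonicalFactor hi (ball_subset_closedBall hwb) hne)
    · simp [Function.locallyFinsuppWithin.apply_eq_zero_of_notMem _ hi]
  have h2 : ∀ z ∈ sphere (0 : ℂ) R, Real.log ‖h z‖ ≤ max 0 (Real.log ‖f z‖) := by
    intro z hz
    rw [hformula z (sphere_subset_closedBall hz) (hs z hz)]
    refine le_trans (le_of_eq ?_) (le_max_right _ _)
    rw [add_eq_right]
    refine finsum_eq_zero_of_forall_eq_zero fun i => ?_
    by_cases hi : i ∈ ball (0 : ℂ) R
    · rw [Complex.norm_canonicalFactor_eval_circle_eq_one hi hz]; simp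
    · simp [Function.locallyFinsuppWithin.apply_eq_zero_of_notMem _ hi]
  have hint : ContinuousOn (fun z => max 0 (Real.log ‖f z‖)) (sphere 0 |R|) := by
    rw [abs_of_pos hR]
    exact continuousOn_const.sup
      (hf.continuous.norm.continuousOn.log fun z hz => norm_ne_zero_iff.2 (hs z hz))
  have h3 := harmonic_le_mul_circleAverage (u := fun z => Real.log ‖h z‖)
    (fun z hz => (D.analyticOnNhd z hz).harmonicAt_log_norm (D.ne_zero z hz)) hwb
    hint.circleIntegrable' h2 fun _ _ => le_max_left _ _
  refine h1.trans (h3.trans ?_)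
  rw [sub_zero]
  refine mul_le_mul_of_nonneg_right ?_ (Real.circleAverage_nonneg_of_nonneg fun _ _ => le_max_left _ _)
  rw [div_le_iff₀ (by linarith)]
  linarith

theorem finite_zeros_of_ne_zero {f : ℂ → ℂ} (hf : Differentiable ℂ f) {x : ℂ} (hx : f x ≠ 0)
    (R : ℝ) : {z : ℂ | ‖z‖ ≤ R ∧ f z = 0}.Finite := by
  have h := (AnalyticOnNhd.preimage_zero_mem_codiscrete (fun z _ => hf.analyticAt z) hx)
  have h2 := (isCompact_closedBall (0 : ℂ) R).finite_sdiff_of_mem_codiscreteWithin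
    (codiscreteWithin_mono (Set.subset_univ _) h)
  refine h2.subset fun z hz => ⟨mem_closedBall_zero_iff.2 hz.1, ?_⟩
  simpa using hz.2

theorem exists_polynomial_of_norm_le_rpow {f : ℂ → ℂ} (hf : Differentiable ℂ f) {C : ℝ} {N : ℕ}
    (h : ∃ᶠ r : ℝ in atTop, ∀ z : ℂ, ‖z‖ = r → ‖f z‖ ≤ C * r ^ N) :
    ∃ p : Polynomial ℂ, ∀ z, f z = p.eval z := by
  have hder : ∀ k, N < k → iteratedDeriv k f 0 = 0 := by
    intro k hk
    rw [← norm_le_zero_iff]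
    have hlim : Tendsto (fun r : ℝ => (k.factorial * C) * (r ^ (k - N))⁻¹) atTop (𝓝 0) := by
      simpa using ((tendsto_pow_atTop (α := ℝ)
        (Nat.sub_ne_zero_of_lt hk)).inv_tendsto_atTop).const_mul ((k.factorial : ℝ) * C)
    refine ge_of_tendsto_of_frequently hlim ?_
    refine (h.and_eventually (eventually_gt_atTop 0)).mono fun r hr => ?_
    have := Complex.norm_iteratedDeriv_le_of_forall_mem_sphere_norm_le k hr.2
      (hf.diffContOnCl (s := Metric.ball 0 r)) fun z hz => hr.1 z (mem_sphere_zero_iff_norm.1 hz)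
    refine this.trans (le_of_eq ?_)
    have hp : r ^ k = r ^ N * r ^ (k - N) := by rw [← pow_add, Nat.add_sub_cancel' hk.le]
    have := hr.2.ne'
    rw [hp]
    field_simp
  refine ⟨∑ k ∈ Finset.range (N + 1),
    Polynomial.C ((k.factorial : ℂ)⁻¹ * iteratedDeriv k f 0) * Polynomial.X ^ k, fun z => ?_⟩
  rw [← Complex.taylorSeries_eq_of_entire' 0 z hf, tsum_eq_sum (s := Finset.range (N + 1))]
  · simp [Polynomial.eval_finsetSum]
  · intro k hk
    rw [hder k (by simpa using hk)]
    simp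

theorem exists_polynomial_of_circleAverage_le_log {f : ℂ → ℂ} (hf : Differentiable ℂ f) {A : ℝ}
    (h : ∃ᶠ r : ℝ in atTop,
      Real.circleAverage (fun z => max 0 (Real.log ‖f z‖)) 0 r ≤ A * Real.log r) :
    ∃ p : Polynomial ℂ, ∀ z, f z = p.eval z := by
  by_cases hne : ∃ x, f x ≠ 0
  swap
  · push Not at hne
    exact ⟨0, by simpa using hne⟩
  obtain ⟨x, hx⟩ := hne
  have hcont : Continuous (Real.circleAverage (fun z => max 0 (Real.log ‖f z‖)) 0) :=
    Real.Continuous.circleAverage (Real.continuous_posLog.comp hf.continuous.norm)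
  have h' : ∃ᶠ r : ℝ in atTop, (∀ z ∈ Metric.sphere (0 : ℂ) r, f z ≠ 0) ∧
      Real.circleAverage (fun z => max 0 (Real.log ‖f z‖)) 0 r ≤ A * Real.log r + 1 := by
    rw [frequently_atTop] at h ⊢
    intro B
    obtain ⟨r, hr, hrA⟩ := h (max B 1)
    have hr1 : 1 ≤ r := (le_max_right _ _).trans hr
    have h1 : ∀ᶠ s in 𝓝 r, Real.circleAverage (fun z => max 0 (Real.log ‖f z‖)) 0 s <
        A * Real.log s + 1 := by
      refine hcont.continuousAt.eventually_lt ?_ (by linarith)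
      exact ((Real.continuousAt_log (by positivity)).const_mul A).add continuousAt_const
    have h2 : ∀ᶠ s in 𝓝[>] r, s ∉ norm '' {z : ℂ | ‖z‖ ≤ r + 1 ∧ f z = 0} := by
      have hfin := (finite_zeros_of_ne_zero hf hx (r + 1)).image norm
      have := (hfin.subset (Set.sdiff_subset (t := {r}))).isClosed.isOpen_compl.mem_nhds
        (show r ∉ _ \ {r} by simp)
      filter_upwards [mem_nhdsWithin_of_mem_nhds this, self_mem_nhdsWithin] with s hs hs' hmem
      exact hs ⟨hmem, (ne_of_gt hs' : s ≠ r)⟩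
    have h3 : ∀ᶠ s in 𝓝[>] r, s < r + 1 :=
      mem_nhdsWithin_of_mem_nhds (Iio_mem_nhds (by linarith))
    obtain ⟨s, hs1, hs2, hs3, hs4⟩ := (((eventually_nhdsWithin_of_eventually_nhds h1).and
      (h2.and (h3.and (eventually_mem_nhdsWithin (a := r) (s := Set.Ioi r))))).exists)
    refine ⟨s, ((le_max_left _ _).trans hr).trans (le_of_lt hs4), fun z hz hfz => hs2 ?_, hs1.le⟩
    have hz' : ‖z‖ = s := mem_sphere_zero_iff_norm.1 hz
    exact ⟨z, ⟨by linarith, hfz⟩, hz'⟩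
  obtain ⟨N, hN⟩ := exists_nat_ge (3 * A)
  refine exists_polynomial_of_norm_le_rpow hf (C := Real.exp 3 * 2 ^ N) (N := N) ?_
  have h2 : ∃ᶠ r : ℝ in atTop, ∀ z : ℂ, ‖z‖ = r / 2 → ‖f z‖ ≤ Real.exp 3 * 2 ^ N * (r / 2) ^ N := by
    refine (h'.and_eventually (eventually_ge_atTop 1)).mono ?_
    rintro r ⟨⟨hr1, hr2⟩, hr3⟩ z hz
    have hr0 : 0 < r := by linarith
    by_cases hfz : f z = 0
    · rw [hfz, norm_zero]; positivity
    have h4 := log_norm_le_mul_circleAverage hf hr0 hr1 hz.le hfz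
    have h5 : Real.log ‖f z‖ ≤ 3 + N * Real.log r := by
      have := mul_le_mul_of_nonneg_right hN (Real.log_nonneg hr3)
      linarith
    rw [Real.log_le_iff_le_exp (norm_pos_iff.2 hfz), Real.exp_add, ← Real.log_pow,
      Real.exp_log (by positivity)] at h5
    refine h5.trans (le_of_eq ?_)
    rw [mul_assoc, ← mul_pow]
    congr 2
    ring
  exact (tendsto_id.atTop_div_const (by norm_num : (0 : ℝ) < 2)).frequently h2

theorem integral_indicator_div {b r : ℝ} (hb : 0 < b) (hbr : b ≤ r) :
    IntervalIntegrable (fun t => (if b ≤ t then 1 else 0) / t) MeasureTheory.volume 0 r ∧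
      ∫ t in (0 : ℝ)..r, (if b ≤ t then 1 else 0) / t = Real.log (r / b) := by
  have hr : 0 < r := hb.trans_le hbr
  have heq : (fun t : ℝ => (if b ≤ t then 1 else 0) / t) = (Set.Ici b).indicator (fun t => t⁻¹) := by
    ext t
    by_cases h : b ≤ t <;> simp [h]
  have hinter : Set.Ioc 0 r ∩ Set.Ici b = Set.Icc b r := by
    ext t
    simp only [Set.mem_inter_iff, Set.mem_Ioc, Set.mem_Ici, Set.mem_Icc]
    constructor
    · rintro ⟨⟨_, h1⟩, h2⟩; exact ⟨h2, h1⟩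
    · rintro ⟨h1, h2⟩; exact ⟨⟨hb.trans_le h1, h2⟩, h1⟩
  have hcont : ContinuousOn (fun t : ℝ => t⁻¹) (Set.Icc b r) :=
    continuousOn_inv₀.mono fun t ht => (hb.trans_le ht.1).ne'
  rw [heq]
  constructor
  · rw [intervalIntegrable_iff_integrableOn_Ioc_of_le hr.le,
      MeasureTheory.IntegrableOn, MeasureTheory.integrable_indicator_iff measurableSet_Ici,
      MeasureTheory.IntegrableOn, MeasureTheory.Measure.restrict_restrict measurableSet_Ici,
      Set.inter_comm, hinter]
    exact hcont.integrableOn_Icc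
  · rw [intervalIntegral.integral_of_le hr.le, MeasureTheory.setIntegral_indicator measurableSet_Ici,
      hinter, MeasureTheory.integral_Icc_eq_integral_Ioc, ← intervalIntegral.integral_of_le hbr,
      integral_inv_of_pos hb hr]

theorem countingBarFn_eq_sum {f : ℂ → ℂ} {a : ℂ} (h0 : f 0 ≠ a) {r : ℝ} (hr : 0 < r)
    (hfin : {z : ℂ | ‖z‖ ≤ r ∧ f z = a}.Finite) :
    countingBarFn r a f = ∑ z ∈ hfin.toFinset, Real.log (r / ‖z‖) := by
  classical
  have hpos : ∀ z ∈ hfin.toFinset, 0 < ‖z‖ ∧ ‖z‖ ≤ r := by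
    intro z hz
    rw [Set.Finite.mem_toFinset] at hz
    refine ⟨norm_pos_iff.2 ?_, hz.1⟩
    rintro rfl
    exact h0 hz.2
  have hcard : Set.EqOn (fun t : ℝ => (Set.ncard {z : ℂ | ‖z‖ ≤ t ∧ f z = a} : ℝ) / t)
      (fun t => ∑ z ∈ hfin.toFinset, (if ‖z‖ ≤ t then 1 else 0) / t) (Set.uIcc 0 r) := by
    intro t ht
    rw [Set.uIcc_of_le hr.le] at ht
    have hset : {z : ℂ | ‖z‖ ≤ t ∧ f z = a} = (hfin.toFinset.filter fun z => ‖z‖ ≤ t : Set ℂ) := by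
      ext z
      simp only [Finset.coe_filter, Set.Finite.mem_toFinset, Set.mem_ofPred_eq]
      exact ⟨fun h => ⟨⟨h.1.trans ht.2, h.2⟩, h.1⟩, fun h => ⟨h.2, h.1.2⟩⟩
    simp only
    rw [hset, Set.ncard_coe_finset, ← Finset.sum_div, Finset.sum_boole]
  rw [countingBarFn, intervalIntegral.integral_congr hcard, intervalIntegral.integral_finsetSum
    fun z hz => (integral_indicator_div (hpos z hz).1 (hpos z hz).2).1]
  exact Finset.sum_congr rfl fun z hz => (integral_indicator_div (hpos z hz).1 (hpos z hz).2).2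

theorem countingBarFn_eq_zero {f : ℂ → ℂ} {a : ℂ} (h0 : f 0 = a) {r : ℝ} (hr : 0 < r)
    (hfin : {z : ℂ | ‖z‖ ≤ r ∧ f z = a}.Finite) : countingBarFn r a f = 0 := by
  refine intervalIntegral.integral_undef fun h => ?_
  have h1 : IntervalIntegrable (fun t : ℝ => t⁻¹) MeasureTheory.volume 0 r := by
    rw [intervalIntegrable_iff_integrableOn_Ioc_of_le hr.le] at h ⊢
    refine h.mono' measurable_inv.aestronglyMeasurable ?_
    rw [MeasureTheory.ae_restrict_iff' measurableSet_Ioc]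
    refine Eventually.of_forall fun t ht => ?_
    have hc : 1 ≤ Set.ncard {z : ℂ | ‖z‖ ≤ t ∧ f z = a} := by
      rw [Nat.one_le_iff_ne_zero, ← Nat.pos_iff_ne_zero,
        Set.ncard_pos
        (hfin.subset fun z hz => ⟨hz.1.trans ht.2, hz.2⟩)]
      exact ⟨0, by simpa using ht.1.le, h0⟩
    rw [Real.norm_of_nonneg (inv_nonneg.2 ht.1.le), inv_eq_one_div]
    have := ht.1
    gcongr
    exact_mod_cast hc
  rw [intervalIntegrable_inv_iff] at h1
  rcases h1 with h1 | h1
  · exact hr.ne h1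
  · exact h1 Set.left_mem_uIcc

theorem one_le_divisor {g : ℂ → ℂ} (hg : Differentiable ℂ g) {x : ℂ} (hx : g x ≠ 0) {U : Set ℂ}
    {u : ℂ} (huU : u ∈ U) (hu : g u = 0) :
    1 ≤ MeromorphicOn.divisor g U u ∧
      (deriv g u = 0 → 2 ≤ MeromorphicOn.divisor g U u) := by
  have hana : AnalyticOnNhd ℂ g Set.univ := fun z _ => hg.analyticAt z
  have htop : analyticOrderAt g u ≠ ⊤ := by
    intro h
    rw [analyticOrderAt_eq_top] at h
    have := hana.eq_of_eventuallyEq (analyticOnNhd_const (v := (0 : ℂ))) h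
    exact hx (congrFun this x)
  have h1 := (hana u trivial).analyticOrderAt_deriv_add_one
  simp only [hu, sub_zero] at h1
  rw [MeromorphicOn.AnalyticOnNhd.divisor_apply (hana.mono (Set.subset_univ U)) huU]
  have h2 : deriv g u = 0 → analyticOrderAt (deriv g) u ≠ 0 := fun h =>
    (hana.deriv u trivial).analyticOrderAt_ne_zero.2 h
  have htop' : analyticOrderAt (deriv g) u ≠ ⊤ := fun h => htop (by rw [← h1, h]; rfl)
  rw [← h1]
  generalize analyticOrderAt (deriv g) u = m at *
  lift m to ℕ using htop'
  have h3 : ((((m : ℕ∞) + 1).map (↑) : WithTop ℤ)).untop₀ = (m : ℤ) + 1 := rfl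
  rw [h3]
  refine ⟨by omega, fun h => ?_⟩
  have : m ≠ 0 := by exact_mod_cast h2 h
  omega

theorem proximityFn_eq_circleAverage (r : ℝ) (f : ℂ → ℂ) :
    proximityFn r f = Real.circleAverage (fun z => max 0 (Real.log ‖f z‖)) 0 r := by
  simp [proximityFn, Real.circleAverage, circleMap]

theorem countingBarFn_nonneg {r : ℝ} (hr : 0 ≤ r) (a : ℂ) (f : ℂ → ℂ) :
    0 ≤ countingBarFn r a f :=
  intervalIntegral.integral_nonneg hr fun _ ht => div_nonneg (Nat.cast_nonneg _) ht.1

theorem nevanlinnaT_nonneg (r : ℝ) (f : ℂ → ℂ) : 0 ≤ nevanlinnaT r f := by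
  rw [nevanlinnaT, proximityFn_eq_circleAverage]
  exact Real.circleAverage_nonneg_of_nonneg fun _ _ => le_max_left _ _

theorem circleAverage_log_norm_sub_le {f : ℂ → ℂ} (hf : Differentiable ℂ f) (a : ℂ) (r : ℝ) :
    Real.circleAverage (fun z => Real.log ‖f z - a‖) 0 r ≤
      nevanlinnaT r f + (Real.posLog ‖a‖ + Real.log 2) := by
  have hcont : Continuous fun z => max 0 (Real.log ‖f z‖) :=
    Real.continuous_posLog.comp hf.continuous.norm
  rw [nevanlinnaT, proximityFn_eq_circleAverage,
    ← Real.circleAverage_const (Real.posLog ‖a‖ + Real.log 2) 0 r,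
    ← Real.circleAverage_fun_add hcont.continuousOn.circleIntegrable' (circleIntegrable_const _ _ _)]
  refine Real.circleAverage_mono (MeromorphicOn.circleIntegrable_log_norm fun z _ =>
    ((hf.sub_const a).analyticAt z).meromorphicAt)
    (hcont.add continuous_const).continuousOn.circleIntegrable' fun z _ => ?_
  have h1 : Real.log ‖f z - a‖ ≤ Real.posLog ‖f z - a‖ := le_max_right _ _
  have h2 := Real.posLog_norm_add_le (f z) (-a)
  rw [norm_neg, ← sub_eq_add_neg, add_assoc] at h2
  exact h1.trans h2

theorem countingBarFn_le_of_finite_simple {f : ℂ → ℂ} (hf : Differentiable ℂ f) {a : ℂ}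
    (h0 : f 0 ≠ a) (hS : {z : ℂ | f z = a ∧ deriv f z ≠ 0}.Finite) :
    ∃ A B : ℝ, 0 ≤ A ∧ ∀ r : ℝ, 1 ≤ r →
      countingBarFn r a f ≤ 1 / 2 * nevanlinnaT r f + A * Real.log r + B := by
  classical
  refine ⟨1 / 2 * hS.toFinset.card, 1 / 2 * (Real.posLog ‖a‖ + Real.log 2 - Real.log ‖f 0 - a‖) +
    1 / 2 * ∑ z ∈ hS.toFinset, |Real.log ‖z‖|, by positivity, fun r hr => ?_⟩
  have hr0 : 0 < r := by linarith
  have hg : Differentiable ℂ fun z => f z - a := hf.sub_const a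
  have hg0 : f 0 - a ≠ 0 := sub_ne_zero.2 h0
  have hfin : {z : ℂ | ‖z‖ ≤ r ∧ f z = a}.Finite := by
    simpa [sub_eq_zero] using finite_zeros_of_ne_zero hg hg0 r
  have hjensen := AnalyticOnNhd.circleAverage_log_norm (c := 0) hr0.ne'
    (fun z _ => hg.analyticAt z) hg0
  have hpos : ∀ z ∈ hfin.toFinset, 0 < ‖z‖ ∧ ‖z‖ ≤ r := by
    intro z hz
    rw [Set.Finite.mem_toFinset] at hz
    refine ⟨norm_pos_iff.2 ?_, hz.1⟩
    rintro rfl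
    exact h0 hz.2
  have hlog : ∀ z ∈ hfin.toFinset, 0 ≤ Real.log (r / ‖z‖) := fun z hz =>
    Real.log_nonneg ((one_le_div (hpos z hz).1).2 (hpos z hz).2)
  rw [finsum_eq_sum_of_support_subset (s := hfin.toFinset)] at hjensen
  swap
  · intro u hu
    rw [Function.mem_support] at hu
    have hD : MeromorphicOn.divisor (fun z => f z - a) (Metric.closedBall 0 |r|) u ≠ 0 := by
      intro h; rw [h] at hu; simp at hu
    have hmem : u ∈ Metric.closedBall (0 : ℂ) |r| := by
      by_contra h
      exact hD (Function.locallyFinsuppWithin.apply_eq_zero_of_notMem _ h)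
    rw [Finset.mem_coe, Set.Finite.mem_toFinset]
    refine ⟨by simpa [abs_of_pos hr0] using hmem, ?_⟩
    by_contra h
    apply hD
    rw [MeromorphicOn.AnalyticOnNhd.divisor_apply (fun z _ => hg.analyticAt z) hmem,
      (hg.analyticAt u).analyticOrderAt_eq_zero.2 (sub_ne_zero.2 h)]
    rfl
  have hterm : ∀ z ∈ hfin.toFinset, 2 * Real.log (r / ‖z‖) ≤
      MeromorphicOn.divisor (fun z => f z - a) (Metric.closedBall 0 |r|) z *
        Real.log (r * ‖0 - z‖⁻¹) + if deriv f z ≠ 0 then Real.log (r / ‖z‖) else 0 := by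
    intro z hz
    have hz' := hz
    rw [Set.Finite.mem_toFinset] at hz'
    rw [zero_sub, norm_neg, ← div_eq_mul_inv]
    have hD := one_le_divisor hg hg0 (U := Metric.closedBall 0 |r|) (u := z)
      (by simpa [abs_of_pos hr0] using hz'.1) (sub_eq_zero.2 hz'.2)
    rw [deriv_sub_const_fun] at hD
    have hl := hlog z hz
    split_ifs with h
    · have : (1 : ℝ) ≤ MeromorphicOn.divisor (fun z => f z - a) (Metric.closedBall 0 |r|) z := by
        exact_mod_cast hD.1
      nlinarith
    · have : (2 : ℝ) ≤ MeromorphicOn.divisor (fun z => f z - a) (Metric.closedBall 0 |r|) z := by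
        exact_mod_cast hD.2 (not_not.1 h)
      nlinarith
  have hsum := Finset.sum_le_sum hterm
  rw [← Finset.mul_sum, Finset.sum_add_distrib, ← countingBarFn_eq_sum h0 hr0 hfin] at hsum
  have hsimple : (∑ z ∈ hfin.toFinset, if deriv f z ≠ 0 then Real.log (r / ‖z‖) else 0) ≤
      hS.toFinset.card * Real.log r + ∑ z ∈ hS.toFinset, |Real.log ‖z‖| := by
    rw [← Finset.sum_filter, ← nsmul_eq_mul, ← Finset.sum_const, ← Finset.sum_add_distrib]
    refine (Finset.sum_le_sum (g := fun z => Real.log r + |Real.log ‖z‖|) fun z hz => ?_).trans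
      (Finset.sum_le_sum_of_subset_of_nonneg ?_ fun z _ _ => ?_)
    · rw [Real.log_div hr0.ne' (hpos z (Finset.mem_filter.1 hz).1).1.ne']
      linarith [neg_abs_le (Real.log ‖z‖)]
    · intro z hz
      rw [Finset.mem_filter, Set.Finite.mem_toFinset] at hz
      rw [Set.Finite.mem_toFinset]
      exact ⟨hz.1.2, hz.2⟩
    · exact add_nonneg (Real.log_nonneg hr) (abs_nonneg _)
  have hT := circleAverage_log_norm_sub_le hf a r
  rw [hjensen] at hT
  linarith

theorem infinite_simple_preimage_of_truncatedDefect_lt {f : ℂ → ℂ} (hf : TranscendentalEntire f)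
    {a : ℂ} (ha : truncatedDefect a f < 1 / 2) : {z : ℂ | f z = a ∧ deriv f z ≠ 0}.Infinite := by
  intro hS
  have hlim : 1 / 2 < limsup (fun r : ℝ => countingBarFn r a f / nevanlinnaT r f) atTop := by
    rw [truncatedDefect] at ha
    linarith
  obtain ⟨c, hc, hc'⟩ := exists_between hlim
  have hfreq := frequently_lt_of_lt_limsup (isCoboundedUnder_le_of_eventually_le _
    ((eventually_ge_atTop 0).mono fun r hr =>
      div_nonneg (countingBarFn_nonneg hr a f) (nevanlinnaT_nonneg r f))) hc'
  obtain ⟨x, hx⟩ : ∃ x, f x - a ≠ 0 := by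
    by_contra! h
    exact hf.2 ⟨Polynomial.C a, fun z => by simpa [sub_eq_zero] using h z⟩
  have hfin : ∀ r : ℝ, {z : ℂ | ‖z‖ ≤ r ∧ f z = a}.Finite := fun r => by
    simpa [sub_eq_zero] using finite_zeros_of_ne_zero (hf.1.sub_const a) hx r
  have h0 : f 0 ≠ a := by
    intro h0
    obtain ⟨r, hr, hr0⟩ := (hfreq.and_eventually (eventually_gt_atTop 0)).exists
    rw [countingBarFn_eq_zero h0 hr0 (hfin r), zero_div] at hr
    linarith
  obtain ⟨A, B, hA, hAB⟩ := countingBarFn_le_of_finite_simple hf.1 h0 hS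
  refine hf.2 (exists_polynomial_of_circleAverage_le_log hf.1 (A := (A + |B|) / (c - 1 / 2)) ?_)
  refine (hfreq.and_eventually (eventually_ge_atTop (Real.exp 1))).mono fun r hr => ?_
  obtain ⟨hr, hre⟩ := hr
  have hr1 : 1 ≤ r := (Real.one_le_exp zero_le_one).trans hre
  have hlog : 1 ≤ Real.log r := (Real.le_log_iff_exp_le (by linarith)).2 hre
  have hT : 0 < nevanlinnaT r f := by
    refine (nevanlinnaT_nonneg r f).lt_of_ne fun h => ?_
    rw [← h, div_zero] at hr
    linarith
  rw [lt_div_iff₀ hT] at hr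
  rw [← proximityFn_eq_circleAverage, ← nevanlinnaT, div_mul_eq_mul_div,
    le_div_iff₀ (by linarith)]
  nlinarith [hAB r hr1, le_abs_self B, abs_nonneg B]

/-- A quantitative form of Hurwitz's theorem at a simple zero of the limit. -/
theorem eventually_exists_zero_of_simple_zero {F : ℕ → ℂ → ℂ} {G : ℂ → ℂ}
    (hF : ∀ n, Differentiable ℂ (F n)) (hG : Differentiable ℂ G)
    (hlim : TendstoLocallyUniformlyOn F G atTop Set.univ) {ζ : ℂ} (h0 : G ζ = 0)
    (h1 : deriv G ζ ≠ 0) {δ : ℝ} (hδ : 0 < δ) :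
    ∃ c > 0, ∀ᶠ n in atTop, ∃ z ∈ Metric.closedBall ζ δ, F n z = 0 ∧ c ≤ ‖deriv (F n) z‖ := by
  set d := ‖deriv G ζ‖ with hd
  have hd0 : 0 < d := norm_pos_iff.2 h1
  have hG' : Continuous (deriv G) := hG.deriv.continuous
  obtain ⟨r, hr, hrG⟩ := Metric.continuousAt_iff.1 hG'.continuousAt (d / 4) (by positivity)
  set s := min δ (r / 2) with hs
  have hs0 : 0 < s := lt_min hδ (by positivity)
  have hderiv : TendstoLocallyUniformlyOn (deriv ∘ F) (deriv G) atTop Set.univ :=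
    hlim.deriv (Eventually.of_forall fun n => (hF n).differentiableOn) isOpen_univ
  have hK := isCompact_closedBall ζ s
  have hu := (tendstoLocallyUniformlyOn_iff_forall_isCompact isOpen_univ).1 hderiv _
    (Set.subset_univ _) hK
  rw [Metric.tendstoUniformlyOn_iff] at hu
  have hv : Tendsto (fun n => F n ζ) atTop (𝓝 0) := by
    simpa [h0] using hlim.tendsto_at (Set.mem_univ ζ)
  have hv' := hv.norm.eventually_lt_const
    (show ‖(0 : ℂ)‖ < d / 2 * s / 2 / 2 by rw [norm_zero]; positivity)
  refine ⟨d / 2, by positivity, ?_⟩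
  filter_upwards [hu (d / 4) (by positivity), hv'] with n hn hn0
  have hclose : ∀ z ∈ Metric.closedBall ζ s, ‖deriv (F n) z - deriv G ζ‖ ≤ d / 2 := by
    intro z hz
    have hzr : dist z ζ < r := by
      have h2 := Metric.mem_closedBall.1 hz
      have h3 : s ≤ r / 2 := min_le_right _ _
      linarith
    have h2 := hrG hzr
    have h3 := hn z hz
    rw [dist_comm] at h3
    have h4 := dist_triangle (deriv (F n) z) (deriv G z) (deriv G ζ)
    rw [← dist_eq_norm]
    simp only [Function.comp_apply] at h3
    linarith
  have hlow : ∀ z ∈ Metric.sphere ζ s, d / 2 * s ≤ ‖F n z - F n ζ‖ := by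
    intro z hz
    have hz' : ‖z - ζ‖ = s := mem_sphere_iff_norm.1 hz
    have h2 := (convex_closedBall ζ s).norm_image_sub_le_of_norm_deriv_le
      (f := fun w => F n w - deriv G ζ * w) (C := d / 2) (x := ζ) (y := z)
      (fun w _ => ((hF n).sub (differentiable_id.const_mul _)) w)
      (fun w hw => by
        have : deriv (fun w => F n w - deriv G ζ * w) w = deriv (F n) w - deriv G ζ := by
          rw [deriv_fun_sub (hF n w) (by fun_prop), deriv_const_mul_field, deriv_id'', mul_one]
        rw [this]
        exact hclose w hw)
      (Metric.mem_closedBall_self hs0.le) (Metric.sphere_subset_closedBall hz)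
    have h3 : deriv G ζ * (z - ζ) = (F n z - F n ζ) -
        ((F n z - deriv G ζ * z) - (F n ζ - deriv G ζ * ζ)) := by ring
    have h4 := norm_sub_le (F n z - F n ζ)
      ((F n z - deriv G ζ * z) - (F n ζ - deriv G ζ * ζ))
    rw [← h3, norm_mul, ← hd, hz'] at h4
    rw [hz'] at h2
    linarith
  have hne : ∃ᶠ z in 𝓝 ζ, F n z ≠ F n ζ := by
    intro hcon
    simp only [ne_eq, not_not] at hcon
    have h2 : deriv (F n) ζ = 0 := by
      rw [Filter.EventuallyEq.deriv_eq (f := fun _ => F n ζ) hcon, deriv_const]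
    have h3 := hclose ζ (Metric.mem_closedBall_self hs0.le)
    rw [h2, zero_sub, norm_neg] at h3
    linarith
  obtain ⟨z, hz, hz0⟩ := (hF n).diffContOnCl.ball_subset_image_closedBall hs0 hlow hne
    (show (0 : ℂ) ∈ Metric.ball (F n ζ) (d / 2 * s / 2) by
      rw [Metric.mem_ball, dist_zero_left]
      have : 0 < d / 2 * s / 2 := by positivity
      linarith)
  refine ⟨z, Metric.closedBall_subset_closedBall (min_le_left _ _) hz, hz0, ?_⟩
  have h2 := hclose z hz
  have h3 := norm_sub_norm_le (deriv G ζ) (deriv (F n) z)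
  rw [norm_sub_rev] at h3
  linarith

theorem exists_repelling_fixed_point_near {𝓕 : Set (ℂ → ℂ)} (h𝓕 : ∀ f ∈ 𝓕, Differentiable ℂ f)
    {w₀ : ℂ} (hw₀ : ¬ IsNormalAt 𝓕 Set.univ w₀) {f : ℂ → ℂ} (hf : Differentiable ℂ f)
    (hinf : {z : ℂ | f z = w₀ ∧ deriv f z ≠ 0}.Infinite) {ε : ℝ} (hε : 0 < ε) :
    ∃ w ∈ Metric.ball w₀ ε, ∃ h ∈ 𝓕, (f ∘ h) w = w ∧ 1 < ‖deriv (f ∘ h) w‖ := by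
  obtain ⟨h, y, ρ, g, hh, hρ, hy, hρ0, hg, hg0, hlim⟩ := exists_rescaling_of_not_isNormalAt h𝓕 hw₀
  have hinj : Function.Injective fun i : Fin 4 => (hinf.natEmbedding _ i : ℂ) := fun i j hij =>
    Fin.val_injective ((hinf.natEmbedding _).injective (Subtype.val_injective hij))
  obtain ⟨i, ζ, hζ, hζ'⟩ := exists_simple_preimage hg hg0 hinj
  have hu := (hinf.natEmbedding _ (i : ℕ)).2
  rw [← hζ] at hu
  have hdiff : ∀ n, Differentiable ℂ (h n) := fun n => h𝓕 _ (hh n)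
  have haff : ∀ n, Differentiable ℂ fun ζ : ℂ => y n + ρ n * ζ := fun n => by fun_prop
  have hF : ∀ n, Differentiable ℂ fun ζ => f (h n (y n + ρ n * ζ)) - (y n + ρ n * ζ) := fun n =>
    (hf.comp ((hdiff n).comp (haff n))).sub (haff n)
  have hG : Differentiable ℂ fun ζ => f (g ζ) - w₀ := (hf.comp hg).sub_const w₀
  have hlim' : TendstoLocallyUniformlyOn
      (fun n ζ => f (h n (y n + ρ n * ζ)) - (y n + ρ n * ζ)) (fun ζ => f (g ζ) - w₀) atTop
      Set.univ := by
    rw [tendstoLocallyUniformlyOn_univ,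
      tendstoLocallyUniformly_iff_forall_tendsto] at hlim ⊢
    intro x
    have haffx : Tendsto (fun p : ℕ × ℂ => y p.1 + ρ p.1 * p.2) (atTop ×ˢ 𝓝 x) (𝓝 w₀) := by
      simpa using (hy.comp tendsto_fst).add
        (((Complex.continuous_ofReal.tendsto 0).comp (hρ0.comp tendsto_fst)).mul
          (tendsto_snd (f := (atTop : Filter ℕ)) (g := 𝓝 x)))
    have hgx : Tendsto (fun p : ℕ × ℂ => g p.2) (atTop ×ˢ 𝓝 x) (𝓝 (g x)) :=
      (hg.continuous.tendsto x).comp tendsto_snd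
    have hhx := (tendsto_iff_of_dist (tendsto_uniformity_iff_dist_tendsto_zero.1 (hlim x))).1 hgx
    exact ((((hf.continuous.tendsto _).comp hgx).sub_const w₀).prodMk_nhds
      (((hf.continuous.tendsto _).comp hhx).sub haffx)).mono_right (nhds_le_uniformity _)
  have hG' : deriv (fun ζ => f (g ζ) - w₀) ζ ≠ 0 := by
    rw [deriv_sub_const_fun]
    have : deriv (f ∘ g) ζ = deriv f (g ζ) * deriv g ζ := deriv_comp ζ (hf _) (hg _)
    rw [show (fun ζ => f (g ζ)) = f ∘ g from rfl, this]
    exact mul_ne_zero hu.2 hζ'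
  obtain ⟨c, hc, hev⟩ := eventually_exists_zero_of_simple_zero hF hG hlim'
    (sub_eq_zero.2 hu.1) hG' one_pos
  have hsmall : ∀ᶠ n in atTop, ρ n * 2 < c / 2 ∧ ρ n * (‖ζ‖ + 1) < ε / 2 := by
    have h1 := (hρ0.mul_const (2 : ℝ)).eventually_lt_const
      (show 0 * (2 : ℝ) < c / 2 by simpa using hc)
    have h2 := (hρ0.mul_const (‖ζ‖ + 1)).eventually_lt_const
      (show 0 * (‖ζ‖ + 1) < ε / 2 by simpa using hε)
    exact h1.and h2
  obtain ⟨n, ⟨z, hz, hz0, hzc⟩, ⟨hn1, hn2⟩, hn3⟩ := (hev.and (hsmall.and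
    (hy.eventually (Metric.ball_mem_nhds w₀ (half_pos hε))))).exists
  have hzn : ‖z‖ ≤ ‖ζ‖ + 1 := by
    have h1 := mem_closedBall_iff_norm.1 hz
    have h2 := norm_sub_norm_le z ζ
    linarith
  have hρn := hρ n
  refine ⟨y n + ρ n * z, ?_, h n, hh n, sub_eq_zero.1 hz0, ?_⟩
  · rw [Metric.mem_ball]
    have h1 : dist (y n + ρ n * z) (y n) ≤ ρ n * (‖ζ‖ + 1) := by
      rw [dist_eq_norm, add_sub_cancel_left, norm_mul, Complex.norm_of_nonneg hρn.le]
      gcongr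
    have h2 := dist_triangle (y n + ρ n * z) (y n) w₀
    linarith
  · have hd1 : HasDerivAt (fun ζ : ℂ => y n + ρ n * ζ) (ρ n : ℂ) z := by
      simpa using ((hasDerivAt_id z).const_mul (ρ n : ℂ)).const_add (y n)
    have hd2 : HasDerivAt (fun ζ => f (h n (y n + ρ n * ζ)) - (y n + ρ n * ζ))
        (deriv (f ∘ h n) (y n + ρ n * z) * ρ n - ρ n) z :=
      (((hf.comp (hdiff n)).differentiableAt.hasDerivAt).comp z hd1).fun_sub hd1
    rw [hd2.deriv] at hzc
    have h1 := hzc.trans (norm_sub_le _ _)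
    rw [norm_mul, Complex.norm_of_nonneg hρn.le] at h1
    by_contra! hle
    nlinarith

/-- If `𝓕` is a family of transcendental entire functions whose
Julia like set contains at least three points, then for any `w₀ ∈ J(𝓕)` and any
`f ∈ 𝓕` with `Θ(w₀, f) < 1/2` there exist `wₙ → w₀` and `fₙ ∈ 𝓕` such that each
`wₙ` is a repelling fixed point of `f ∘ fₙ`. -/
theorem repelling_fixed_points_of_comp (𝓕 : Set (ℂ → ℂ))
    (htrans : ∀ f ∈ 𝓕, TranscendentalEntire f)
    (hJ : ∃ a b c : ℂ, a ≠ b ∧ a ≠ c ∧ b ≠ c ∧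
      a ∈ juliaLike 𝓕 Set.univ ∧ b ∈ juliaLike 𝓕 Set.univ ∧
      c ∈ juliaLike 𝓕 Set.univ)
    (w₀ : ℂ) (hw₀ : w₀ ∈ juliaLike 𝓕 Set.univ)
    (f : ℂ → ℂ) (hf : f ∈ 𝓕) (hΘ : truncatedDefect w₀ f < 1 / 2) :
    ∃ (w : ℕ → ℂ) (g : ℕ → ℂ → ℂ), (∀ n, g n ∈ 𝓕) ∧
      Tendsto w atTop (𝓝 w₀) ∧
      ∀ n, (f ∘ g n) (w n) = w n ∧ 1 < ‖deriv (f ∘ g n) (w n)‖ := by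
  have hnormal : ¬ IsNormalAt 𝓕 Set.univ w₀ := fun h => hw₀.2 ⟨Set.mem_univ _, h⟩
  have hinf := infinite_simple_preimage_of_truncatedDefect_lt (htrans f hf) hΘ
  choose w hw g hg hfix using fun n : ℕ =>
    exists_repelling_fixed_point_near (fun h hh => (htrans h hh).1) hnormal (htrans f hf).1 hinf
      (Nat.one_div_pos_of_nat (α := ℝ) (n := n))
  exact ⟨w, g, hg, squeeze_zero (fun _ => dist_nonneg) (fun n => (Metric.mem_ball.1 (hw n)).le)
    tendsto_one_div_add_atTop_nhds_zero_nat |> tendsto_iff_dist_tendsto_zero.2, hfix⟩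
end
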